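/- Let ζ be an extremal number. Then w_{3,2}(ζ) = 2 + √5 and λ_{3,2}(ζ) = 1/√5; in particular w_{3,1}(ζ) = w_{3,2}(ζ) and λ_{3,1}(ζ) = λ_{3,2}(ζ). -/

import Mathlib

open Polynomial

/-- Height of an integer polynomial: the maximum absolute value of its coefficients. -/
noncomputable def polyH (P : Polynomial ℤ) : ℝ :=
  (((P.support.sup fun i => (P.coeff i).natAbs) : ℕ) : ℝ)

/-- Evaluation of an integer polynomial at a real number. -/
noncomputable def pev (ζ : ℝ) (P : Polynomial ℤ) : ℝ := Polynomial.aeval ζ P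

/-- Set of exponents η such that for arbitrarily large X the system
    H(P) ≤ X, 0 < |P(ζ)| ≤ X^(−η) has a solution of degree at most n. -/
def wSet (n : ℕ) (ζ : ℝ) : Set ℝ :=
  {η | ∀ X₀ : ℝ, ∃ X : ℝ, X₀ ≤ X ∧ ∃ P : Polynomial ℤ,
    P.natDegree ≤ n ∧ polyH P ≤ X ∧ 0 < |pev ζ P| ∧ |pev ζ P| ≤ X ^ (-η)}

/-- The exponent w_n(ζ). -/
noncomputable def wExp (n : ℕ) (ζ : ℝ) : ℝ := sSup (wSet n ζ)

/-- Set of exponents η such that for all sufficiently large X the system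
    H(P) ≤ X, 0 < |P(ζ)| ≤ X^(−η) has a solution of degree at most n. -/
def whSet (n : ℕ) (ζ : ℝ) : Set ℝ :=
  {η | ∃ X₀ : ℝ, ∀ X : ℝ, X₀ ≤ X → ∃ P : Polynomial ℤ,
    P.natDegree ≤ n ∧ polyH P ≤ X ∧ 0 < |pev ζ P| ∧ |pev ζ P| ≤ X ^ (-η)}

/-- The uniform exponent ŵ_n(ζ). -/
noncomputable def whExp (n : ℕ) (ζ : ℝ) : ℝ := sSup (whSet n ζ)

/-- Set of exponents η such that for arbitrarily large X the system
    |x| ≤ X, max_{1≤i≤n} |ζ^i x − y_i| ≤ X^(−η) has a nonzero integer solution. -/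
def lamSet (n : ℕ) (ζ : ℝ) : Set ℝ :=
  {η | ∀ X₀ : ℝ, ∃ X : ℝ, X₀ ≤ X ∧ ∃ x : ℤ, ∃ y : Fin n → ℤ,
    (x ≠ 0 ∨ y ≠ 0) ∧ ((|x| : ℤ) : ℝ) ≤ X ∧
    ∀ i : Fin n, |ζ ^ ((i : ℕ) + 1) * (x : ℝ) - (y i : ℝ)| ≤ X ^ (-η)}

/-- The exponent λ_n(ζ). -/
noncomputable def lamExp (n : ℕ) (ζ : ℝ) : ℝ := sSup (lamSet n ζ)

/-- Set of exponents η such that for all sufficiently large X the system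
    |x| ≤ X, max_{1≤i≤n} |ζ^i x − y_i| ≤ X^(−η) has a nonzero integer solution. -/
def lamhSet (n : ℕ) (ζ : ℝ) : Set ℝ :=
  {η | ∃ X₀ : ℝ, ∀ X : ℝ, X₀ ≤ X → ∃ x : ℤ, ∃ y : Fin n → ℤ,
    (x ≠ 0 ∨ y ≠ 0) ∧ ((|x| : ℤ) : ℝ) ≤ X ∧
    ∀ i : Fin n, |ζ ^ ((i : ℕ) + 1) * (x : ℝ) - (y i : ℝ)| ≤ X ^ (-η)}

/-- The uniform exponent λ̂_n(ζ). -/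
noncomputable def lamhExp (n : ℕ) (ζ : ℝ) : ℝ := sSup (lamhSet n ζ)

/-- Set of exponents η such that for arbitrarily large X the polynomial system has
    at least j linearly independent solutions of degree at most n. -/
def wSetJ (n j : ℕ) (ζ : ℝ) : Set ℝ :=
  {η | ∀ X₀ : ℝ, ∃ X : ℝ, X₀ ≤ X ∧ ∃ P : Fin j → Polynomial ℤ,
    LinearIndependent ℤ P ∧ ∀ i : Fin j,
      (P i).natDegree ≤ n ∧ polyH (P i) ≤ X ∧ 0 < |pev ζ (P i)| ∧ |pev ζ (P i)| ≤ X ^ (-η)}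

/-- The exponent w_{n,j}(ζ). -/
noncomputable def wExpJ (n j : ℕ) (ζ : ℝ) : ℝ := sSup (wSetJ n j ζ)

/-- Set of exponents η such that for all sufficiently large X the polynomial system has
    at least j linearly independent solutions of degree at most n. -/
def whSetJ (n j : ℕ) (ζ : ℝ) : Set ℝ :=
  {η | ∃ X₀ : ℝ, ∀ X : ℝ, X₀ ≤ X → ∃ P : Fin j → Polynomial ℤ,
    LinearIndependent ℤ P ∧ ∀ i : Fin j,
      (P i).natDegree ≤ n ∧ polyH (P i) ≤ X ∧ 0 < |pev ζ (P i)| ∧ |pev ζ (P i)| ≤ X ^ (-η)}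

/-- The uniform exponent ŵ_{n,j}(ζ). -/
noncomputable def whExpJ (n j : ℕ) (ζ : ℝ) : ℝ := sSup (whSetJ n j ζ)

/-- Set of exponents η such that for arbitrarily large X the simultaneous approximation
    system has at least j linearly independent integer vector solutions. -/
def lamSetJ (n j : ℕ) (ζ : ℝ) : Set ℝ :=
  {η | ∀ X₀ : ℝ, ∃ X : ℝ, X₀ ≤ X ∧ ∃ v : Fin j → (Fin (n + 1) → ℤ),
    LinearIndependent ℤ v ∧ ∀ i : Fin j,
      ((|v i 0| : ℤ) : ℝ) ≤ X ∧
      ∀ t : Fin n, |ζ ^ ((t : ℕ) + 1) * ((v i 0 : ℤ) : ℝ) - ((v i t.succ : ℤ) : ℝ)| ≤ X ^ (-η)}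

/-- The exponent λ_{n,j}(ζ). -/
noncomputable def lamExpJ (n j : ℕ) (ζ : ℝ) : ℝ := sSup (lamSetJ n j ζ)

/-- Set of exponents η such that for all sufficiently large X the simultaneous approximation
    system has at least j linearly independent integer vector solutions. -/
def lamhSetJ (n j : ℕ) (ζ : ℝ) : Set ℝ :=
  {η | ∃ X₀ : ℝ, ∀ X : ℝ, X₀ ≤ X → ∃ v : Fin j → (Fin (n + 1) → ℤ),
    LinearIndependent ℤ v ∧ ∀ i : Fin j,
      ((|v i 0| : ℤ) : ℝ) ≤ X ∧
      ∀ t : Fin n, |ζ ^ ((t : ℕ) + 1) * ((v i 0 : ℤ) : ℝ) - ((v i t.succ : ℤ) : ℝ)| ≤ X ^ (-η)}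

/-- The uniform exponent λ̂_{n,j}(ζ). -/
noncomputable def lamhExpJ (n j : ℕ) (ζ : ℝ) : ℝ := sSup (lamhSetJ n j ζ)

/-- An extremal number: a real transcendental number with ŵ₂(ζ) = (3+√5)/2. -/
def IsExtremal (ζ : ℝ) : Prop :=
  Transcendental ℚ ζ ∧ whExp 2 ζ = (3 + Real.sqrt 5) / 2

namespace ExtremalNumber

open Real

local notation "φ" => Real.goldenRatio

theorem goldenRatio_gt : (1.618 : ℝ) < φ := by
  have h : (2.236 : ℝ) < √5 := by
    rw [Real.lt_sqrt (by norm_num)]; norm_num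
  unfold Real.goldenRatio; linarith

theorem goldenRatio_lt : φ < (1.6181 : ℝ) := by
  have h : √5 < (2.2362 : ℝ) := by
    rw [Real.sqrt_lt' (by norm_num)]; norm_num
  unfold Real.goldenRatio; linarith

theorem goldenRatio_mul_self : φ * φ = φ + 1 := by
  rw [← sq, Real.goldenRatio_sq]

theorem le_exp_of_le {C x : ℝ} (h : C ≤ x) : C ≤ exp x := by
  have := add_one_le_exp x
  linarith

theorem add_nonneg_of_one_le_mul_exp {C x : ℝ} (h : 1 ≤ C * exp x) : 0 ≤ C + x := by
  have h1 : C * exp x ≤ exp (C + x) := by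
    rw [exp_add]
    exact mul_le_mul_of_nonneg_right (le_exp_of_le le_rfl) (exp_pos x).le
  exact one_le_exp_iff.mp (h.trans h1)

theorem mul_exp_le_exp {C x y : ℝ} (h : C + x ≤ y) : C * exp x ≤ exp y := by
  have h1 : C * exp x ≤ exp (C + x) := by
    rw [exp_add]
    exact mul_le_mul_of_nonneg_right (le_exp_of_le le_rfl) (exp_pos x).le
  exact h1.trans (exp_le_exp.mpr h)

/-- Value at `ζ` of the polynomial of degree at most two with coefficient vector `a`. -/
def quadEval (ζ : ℝ) (a : Fin 3 → ℤ) : ℝ := a 0 + a 1 * ζ + a 2 * ζ ^ 2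

/-- The cross product of two integer vectors. -/
def cross (a b : Fin 3 → ℤ) : Fin 3 → ℤ :=
  ![a 1 * b 2 - a 2 * b 1, a 2 * b 0 - a 0 * b 2, a 0 * b 1 - a 1 * b 0]

/-- Minus the determinant of the symmetric matrix with entries `n 0, n 1, n 1, n 2`. For
`n = cross a b` this is the resultant of the quadratic polynomials with coefficients `a`, `b`. -/
def disc (n : Fin 3 → ℤ) : ℤ := n 1 ^ 2 - n 0 * n 2

/-- The maximum of the absolute values of the coordinates. -/
def height (a : Fin 3 → ℤ) : ℕ := Finset.univ.sup fun i => (a i).natAbs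

@[simp] theorem cross_zero (a b : Fin 3 → ℤ) : cross a b 0 = a 1 * b 2 - a 2 * b 1 := rfl
@[simp] theorem cross_one (a b : Fin 3 → ℤ) : cross a b 1 = a 2 * b 0 - a 0 * b 2 := rfl
@[simp] theorem cross_two (a b : Fin 3 → ℤ) : cross a b 2 = a 0 * b 1 - a 1 * b 0 := rfl

theorem height_le_iff {a : Fin 3 → ℤ} {n : ℕ} : height a ≤ n ↔ ∀ i, |a i| ≤ n := by
  simp only [height, Finset.sup_le_iff, Finset.mem_univ, true_imp_iff]
  exact forall_congr' fun i => by rw [Int.abs_eq_natAbs]; omega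

theorem abs_le_height (a : Fin 3 → ℤ) (i : Fin 3) : |(a i : ℝ)| ≤ height a := by
  exact_mod_cast height_le_iff.mp le_rfl i

theorem height_pos {a : Fin 3 → ℤ} (ha : a ≠ 0) : 0 < height a := by
  by_contra h
  apply ha
  ext i
  have := height_le_iff.mp (show height a ≤ 0 by omega) i
  simpa using this

section Transcendental

variable {ζ : ℝ}

theorem poly_eval_ne_zero (hζ : Transcendental ℚ ζ) {p : Polynomial ℤ} (hp : p ≠ 0) :
    Polynomial.aeval ζ p ≠ 0 := by
  have h : Transcendental ℤ ζ := by
    rwa [Transcendental, ← IsFractionRing.isAlgebraic_iff ℤ ℚ ℝ] at hζ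
  exact fun h0 => h ⟨p, hp, h0⟩

theorem quadEval_ne_zero (hζ : Transcendental ℚ ζ) {a : Fin 3 → ℤ} (ha : a ≠ 0) :
    quadEval ζ a ≠ 0 := by
  intro h
  have hp : (Polynomial.C (a 0) + Polynomial.C (a 1) * Polynomial.X
      + Polynomial.C (a 2) * Polynomial.X ^ 2 : Polynomial ℤ) ≠ 0 := by
    intro h0
    apply ha
    have h1 := congrArg (fun p => Polynomial.coeff p 0) h0
    have h2 := congrArg (fun p => Polynomial.coeff p 1) h0
    have h3 := congrArg (fun p => Polynomial.coeff p 2) h0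
    simp [Polynomial.coeff_X] at h1 h2 h3
    ext i; fin_cases i <;> simp_all
  apply poly_eval_ne_zero hζ hp
  simp only [map_add, map_mul, map_pow, Polynomial.aeval_C, Polynomial.aeval_X]
  simpa [quadEval] using h

theorem sub_mul_ne_zero (hζ : Transcendental ℚ ζ) {s t : ℤ} (hs : s ≠ 0) :
    (t : ℝ) - ζ * s ≠ 0 := by
  have := quadEval_ne_zero hζ (a := ![t, -s, 0]) (fun h => hs (by simpa using congrFun h 1))
  intro h
  apply this
  simp [quadEval]
  linarith

theorem exists_pos_le_abs_sub_mul (hζ : Transcendental ℚ ζ) (N : ℕ) :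
    ∃ δ > 0, ∀ s t : ℤ, s ≠ 0 → |s| ≤ N → δ ≤ |(t : ℝ) - ζ * s| := by
  have hfin := Set.finite_Icc (-(N : ℤ)) N
  obtain ⟨δ, hδ, h⟩ : ∃ δ > 0, ∀ s ∈ (hfin.toFinset.filter (· ≠ 0)),
      δ ≤ |(round (ζ * (s : ℝ)) : ℝ) - ζ * s| := by
    generalize hS : hfin.toFinset.filter (· ≠ 0) = S
    have hne : ∀ s ∈ S, (s : ℤ) ≠ 0 := by
      subst hS; simp
    clear hS
    induction S using Finset.induction_on with
    | empty => exact ⟨1, one_pos, by simp⟩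
    | insert a S ha ih =>
      obtain ⟨δ, hδ, h⟩ := ih fun s hs => hne s (Finset.mem_insert_of_mem hs)
      refine ⟨min δ |(round (ζ * (a : ℝ)) : ℝ) - ζ * a|, lt_min hδ (abs_pos.mpr
        (sub_mul_ne_zero hζ (hne a (Finset.mem_insert_self _ _)))), fun s hs => ?_⟩
      rcases Finset.mem_insert.mp hs with rfl | hs
      · exact min_le_right _ _
      · exact (min_le_left _ _).trans (h s hs)
  refine ⟨δ, hδ, fun s t hs hN => (h s ?_).trans ?_⟩
  · simp [hs, abs_le.mp hN]
  · rw [abs_sub_comm, abs_sub_comm (t : ℝ)]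
    exact round_le _ _

end Transcendental

section Cross

variable {ζ g h : ℝ} {a b c d n z : Fin 3 → ℤ}

theorem abs_cross_le (ha : ∀ i, |(a i : ℝ)| ≤ g) (hb : ∀ i, |(b i : ℝ)| ≤ h) (i : Fin 3) :
    |(cross a b i : ℝ)| ≤ 2 * (g * h) := by
  have hg : 0 ≤ g := (abs_nonneg _).trans (ha 0)
  have key : ∀ i j, |(a i : ℝ) * b j| ≤ g * h := fun i j => by
    rw [abs_mul]; exact mul_le_mul (ha i) (hb j) (abs_nonneg _) hg
  have key2 : ∀ i j k l, |(a i : ℝ) * b j - a k * b l| ≤ 2 * (g * h) := fun i j k l => by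
    have := abs_sub ((a i : ℝ) * b j) (a k * b l)
    linarith [key i j, key k l]
  fin_cases i
  · simpa using key2 1 2 2 1
  · simpa using key2 2 0 0 2
  · simpa using key2 0 1 1 0

theorem abs_mul_sub_mul_le (x y : ℝ) (i j : Fin 3) (ha : ∀ i, |(a i : ℝ)| ≤ g)
    (hb : ∀ i, |(b i : ℝ)| ≤ h) :
    |(a i : ℝ) * y - b j * x| ≤ g * |y| + h * |x| := by
  refine (abs_sub _ _).trans ?_
  rw [abs_mul, abs_mul]
  gcongr
  · exact ha i
  · exact hb j

theorem abs_cross_one_sub_le (ha : ∀ i, |(a i : ℝ)| ≤ g) (hb : ∀ i, |(b i : ℝ)| ≤ h) :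
    |(cross a b 1 : ℝ) - ζ * cross a b 0| ≤ g * |quadEval ζ b| + h * |quadEval ζ a| := by
  have := abs_mul_sub_mul_le (quadEval ζ a) (quadEval ζ b) 2 2 ha hb
  convert this using 2
  simp [quadEval]; ring

theorem abs_cross_two_sub_sq_le (ha : ∀ i, |(a i : ℝ)| ≤ g) (hb : ∀ i, |(b i : ℝ)| ≤ h) :
    |(cross a b 2 : ℝ) - ζ ^ 2 * cross a b 0| ≤ g * |quadEval ζ b| + h * |quadEval ζ a| := by
  have := abs_mul_sub_mul_le (quadEval ζ a) (quadEval ζ b) 1 1 ha hb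
  rw [← abs_neg] at this
  convert this using 2
  simp [quadEval]; ring

theorem abs_two_sub_le {l : ℝ} (h1 : |(n 1 : ℝ) - ζ * n 0| ≤ l)
    (h2 : |(n 2 : ℝ) - ζ ^ 2 * n 0| ≤ l) : |(n 2 : ℝ) - ζ * n 1| ≤ (1 + |ζ|) * l := by
  have : (n 2 : ℝ) - ζ * n 1 = (n 2 - ζ ^ 2 * n 0) - ζ * (n 1 - ζ * n 0) := by ring
  rw [this]
  refine (abs_sub _ _).trans ?_
  rw [abs_mul]
  nlinarith [mul_le_mul_of_nonneg_left h1 (abs_nonneg ζ)]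

theorem abs_disc_le {m l : ℝ} (hm : ∀ i, |(n i : ℝ)| ≤ m) (h1 : |(n 1 : ℝ) - ζ * n 0| ≤ l)
    (h2 : |(n 2 : ℝ) - ζ ^ 2 * n 0| ≤ l) : |(disc n : ℝ)| ≤ (2 + |ζ|) * (m * l) := by
  have : (disc n : ℝ) = n 1 * (n 1 - ζ * n 0) - n 0 * (n 2 - ζ * n 1) := by
    simp [disc]; ring
  rw [this]
  refine (abs_sub _ _).trans ?_
  rw [abs_mul, abs_mul]
  have hl : 0 ≤ l := (abs_nonneg _).trans h1
  have hm0 : 0 ≤ m := (abs_nonneg _).trans (hm 0)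
  have e1 := mul_le_mul (hm 1) h1 (abs_nonneg _) hm0
  have e2 := mul_le_mul (hm 0) (abs_two_sub_le h1 h2) (abs_nonneg _) hm0
  nlinarith

/-- Two vectors in the plane with normal vector `n` have their cross product parallel to `n`. -/
theorem cross_mul_comm (hc : n 0 * c 0 + n 1 * c 1 + n 2 * c 2 = 0)
    (hd : n 0 * d 0 + n 1 * d 1 + n 2 * d 2 = 0) (i j : Fin 3) :
    cross c d i * n j = cross c d j * n i := by
  fin_cases i <;> fin_cases j <;> simp
  · linear_combination d 2 * hc - c 2 * hd
  · linear_combination c 1 * hd - d 1 * hc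
  · linear_combination c 2 * hd - d 2 * hc
  · linear_combination d 0 * hc - c 0 * hd
  · linear_combination d 1 * hc - c 1 * hd
  · linear_combination c 0 * hd - d 0 * hc

theorem disc_ne_zero_of_parallel (hz : z ≠ 0) (hn : disc n ≠ 0)
    (hp : ∀ i j, z i * n j = z j * n i) : disc z ≠ 0 := by
  obtain ⟨j, hj⟩ := Function.ne_iff.mp hz
  have hj : z j ≠ 0 := hj
  have : disc z * n j ^ 2 = z j ^ 2 * disc n := by
    unfold disc
    linear_combination (z 1 * n j + z j * n 1) * hp 1 j - z 0 * n j * hp 2 j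
      - z j * n 2 * hp 0 j
  intro h0
  rw [h0, zero_mul] at this
  exact (mul_ne_zero (pow_ne_zero 2 hj) hn) this.symm

theorem mul_comm_of_cross_eq_zero (h : cross a b = 0) (i j : Fin 3) :
    a i * b j = a j * b i := by
  have h0 := congrFun h 0
  have h1 := congrFun h 1
  have h2 := congrFun h 2
  simp at h0 h1 h2
  fin_cases i <;> fin_cases j <;> simp <;> linarith

theorem mul_quadEval_of_cross_eq_zero (h : cross a b = 0) (i : Fin 3) :
    (b i : ℝ) * quadEval ζ a = a i * quadEval ζ b := by
  have key : ∀ j, (a i : ℝ) * b j = a j * b i := fun j => by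
    exact_mod_cast mul_comm_of_cross_eq_zero h i j
  unfold quadEval
  linear_combination -key 0 - ζ * key 1 - ζ ^ 2 * key 2

/-- If an integer vector `z ≠ 0` is parallel to `n` with `disc n ≠ 0`, then the size of `n` and
the quality of approximation given by `z` are bounded below. -/
theorem one_le_of_parallel {m l : ℝ} (hz : z ≠ 0) (hn : disc n ≠ 0)
    (hp : ∀ i j, z i * n j = z j * n i) (hm : ∀ i, |(n i : ℝ)| ≤ m)
    (h1 : |(z 1 : ℝ) - ζ * z 0| ≤ l) (h2 : |(z 2 : ℝ) - ζ ^ 2 * z 0| ≤ l) :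
    1 ≤ (2 + |ζ|) * (m * l) := by
  obtain ⟨i, hi⟩ : ∃ i, n i ≠ 0 := by
    by_contra! h
    exact hn (by simp [disc, h])
  obtain ⟨r1, r2, hcop, e1, e2⟩ : ∃ r1 r2 : ℤ, IsCoprime r1 r2 ∧
      z i = r1 * (Int.gcd (z i) (n i)) ∧ n i = r2 * (Int.gcd (z i) (n i)) := by
    have hpos : 0 < Int.gcd (z i) (n i) := Int.gcd_pos_of_ne_zero_right _ hi
    obtain ⟨r1, r2, hc, e1, e2⟩ := Int.exists_gcd_one hpos
    exact ⟨r1, r2, Int.isCoprime_iff_gcd_eq_one.mpr hc, e1, e2⟩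
  have hg : ((Int.gcd (z i) (n i) : ℕ) : ℤ) ≠ 0 := by
    intro h; rw [h, mul_zero] at e2; exact hi e2
  have hr2 : r2 ≠ 0 := by
    rintro rfl; exact hi (by simpa using e2)
  have hzr : ∀ j, z j * r2 = r1 * n j := fun j => by
    apply mul_right_cancel₀ hg
    linear_combination (-z j) * e2 + n j * e1 + hp j i
  have hdvd : ∀ j, r2 ∣ n j := fun j =>
    hcop.symm.dvd_of_dvd_mul_left ⟨z j, by linear_combination -hzr j⟩
  choose y hy using hdvd
  have hzy : ∀ j, z j = r1 * y j := fun j => by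
    apply mul_right_cancel₀ hr2
    linear_combination hzr j + r1 * hy j
  have hr1 : r1 ≠ 0 := by
    rintro rfl
    exact hz (by ext j; simp [hzy j])
  have hyd : disc y ≠ 0 := by
    intro h
    apply hn
    unfold disc at h ⊢
    rw [hy 0, hy 1, hy 2]
    linear_combination r2 ^ 2 * h
  have abs_ge : ∀ (r : ℤ) (x w : ℝ), r ≠ 0 → |(r : ℝ) * x| ≤ w → |x| ≤ w := by
    intro r x w hr h
    rw [abs_mul] at h
    have : (1 : ℝ) ≤ |(r : ℝ)| := by exact_mod_cast Int.one_le_abs hr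
    nlinarith [abs_nonneg x]
  have hd : (1 : ℝ) ≤ |(disc y : ℝ)| := by exact_mod_cast Int.one_le_abs hyd
  refine hd.trans (abs_disc_le (fun j => abs_ge r2 _ _ hr2 ?_) (abs_ge r1 _ _ hr1 ?_)
    (abs_ge r1 _ _ hr1 ?_))
  · have := hm j; rw [hy j] at this; push_cast at this; exact this
  · have := h1; rw [hzy 0, hzy 1] at this; push_cast at this
    convert this using 2; ring
  · have := h2; rw [hzy 0, hzy 2] at this; push_cast at this
    convert this using 2; ring

end Cross

/-- The consequence of `ŵ₂(ζ) ≥ φ + 1` used throughout. -/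
def UniformApprox (ζ : ℝ) : Prop :=
  ∀ ε > 0, ∃ X₀ : ℝ, ∀ X ≥ X₀, ∃ a : Fin 3 → ℤ, a ≠ 0 ∧ (∀ i, |(a i : ℝ)| ≤ X) ∧
    |quadEval ζ a| ≤ exp (-(φ + 1 - ε) * log X)

theorem exists_abs_le_of_root {c : Fin 3 → ℤ} {s t : ℤ} (hc : c ≠ 0) (hcop : IsCoprime s t)
    (hs : s ≠ 0) (h : c 0 * s ^ 2 + c 1 * (s * t) + c 2 * t ^ 2 = 0) : ∃ i, |s| ≤ |c i| := by
  by_cases h2 : c 2 = 0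
  · have h1 : c 0 * s + c 1 * t = 0 := by
      apply mul_right_cancel₀ hs
      rw [h2] at h
      linear_combination h
    have hd : s ∣ c 1 := hcop.dvd_of_dvd_mul_right ⟨-c 0, by linear_combination h1⟩
    refine ⟨1, Int.le_of_dvd (abs_pos.mpr fun h0 => hc ?_) ((abs_dvd_abs _ _).mpr hd)⟩
    have : c 0 = 0 := by
      rw [h0] at h1
      simpa [hs] using h1
    ext i; fin_cases i <;> simp_all
  · have hd : s ∣ c 2 := (hcop.pow_right (n := 2)).dvd_of_dvd_mul_right
      ⟨-c 0 * s - c 1 * t, by linear_combination h⟩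
    exact ⟨2, Int.le_of_dvd (abs_pos.mpr h2) ((abs_dvd_abs _ _).mpr hd)⟩

theorem exists_eq_sq_of_disc_eq_zero {ζ l : ℝ} {n : Fin 3 → ℤ} (hn : n ≠ 0) (hd : disc n = 0)
    (h2 : |(n 2 : ℝ) - ζ ^ 2 * n 0| ≤ l) (hl : l < 1) :
    ∃ s t d : ℤ, IsCoprime s t ∧ s ≠ 0 ∧ d ≠ 0 ∧ n 0 = d * s ^ 2 ∧ n 1 = d * (s * t) ∧
      n 2 = d * t ^ 2 := by
  unfold disc at hd
  have h0 : n 0 ≠ 0 := by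
    intro h0
    have h1 : n 1 = 0 := by
      rw [h0] at hd; simpa using hd
    have h2' : n 2 = 0 := by
      rw [h0] at h2
      have h3 : |(n 2 : ℝ)| < 1 := by simpa using h2.trans_lt hl
      exact Int.abs_lt_one_iff.mp (by exact_mod_cast h3)
    apply hn
    ext i; fin_cases i <;> simp_all
  obtain ⟨s, t, hc, e1, e2⟩ := Int.exists_gcd_one (Int.gcd_pos_of_ne_zero_left (n 1) h0)
  have hcop : IsCoprime s t := Int.isCoprime_iff_gcd_eq_one.mpr hc
  generalize ((Int.gcd (n 0) (n 1) : ℕ) : ℤ) = g at e1 e2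
  have hg : g ≠ 0 := by rintro rfl; simp_all
  have hs : s ≠ 0 := by rintro rfl; simp_all
  have h3 : g * t ^ 2 = s * n 2 := by
    apply mul_left_cancel₀ hg
    rw [e1, e2] at hd
    linear_combination hd
  obtain ⟨d, rfl⟩ : s ∣ g := (hcop.pow_right (n := 2)).dvd_of_dvd_mul_right ⟨n 2, h3⟩
  refine ⟨s, t, d, hcop, hs, right_ne_zero_of_mul hg, by rw [e1]; ring, by rw [e2]; ring, ?_⟩
  apply mul_left_cancel₀ hs
  linear_combination -h3

theorem quadratic_form_eq (ζ : ℝ) (c : Fin 3 → ℤ) (s t : ℤ) :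
    ((c 0 * s ^ 2 + c 1 * (s * t) + c 2 * t ^ 2 : ℤ) : ℝ) =
      s ^ 2 * quadEval ζ c + (t - ζ * s) * (c 1 * s + c 2 * (t + ζ * s)) := by
  unfold quadEval; push_cast; ring

theorem sq_mul_exp {x k : ℝ} (hx : 0 < x) :
    (x : ℝ) ^ 2 * exp (-k * log x) = exp (-(k - 2) * log x) := by
  have : x ^ 2 = exp (2 * log x) := by
    rw [mul_comm, exp_mul, exp_log hx]; norm_num
  rw [this, ← exp_add]; ring_nf

theorem mul_exp_log {x k : ℝ} (hx : 0 < x) :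
    (x : ℝ) * exp (-k * log x) = exp (-(k - 1) * log x) := by
  nth_rw 1 [← exp_log hx]
  rw [← exp_add]; ring_nf

theorem mul_exp_neg_lt {C k L : ℝ} (h : C + 2 ≤ k * L) : C * exp (-k * L) < 1 / 4 := by
  have h1 : C * exp (-k * L) ≤ exp (-2) := mul_exp_le_exp (by linarith)
  have h2 : exp (-2) < 1 / 4 := by
    rw [exp_neg, inv_eq_one_div]
    apply one_div_lt_one_div_of_lt (by norm_num)
    have e : exp 2 = exp 1 * exp 1 := by rw [← exp_add]; norm_num
    have := exp_one_gt_d9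
    rw [e]; nlinarith
  linarith

set_option maxHeartbeats 1000000 in
/-- Two non-proportional quadratic integer polynomials that both approximate `0` at `ζ` as well
as the uniform exponent permits are coprime. -/
theorem disc_cross_ne_zero {ζ : ℝ} (hζ : Transcendental ℚ ζ) (hU : UniformApprox ζ) {ε : ℝ}
    (h0 : 0 < ε) (h1 : ε ≤ 1 / 10) :
    ∃ H₀ : ℝ, ∀ h ≥ H₀, ∀ a b : Fin 3 → ℤ, (∀ i, |(a i : ℝ)| ≤ h) → (∀ i, |(b i : ℝ)| ≤ h) →
      |quadEval ζ a| ≤ exp (-(φ + 1 - ε) * log h) → |quadEval ζ b| ≤ exp (-(φ + 1 - ε) * log h) →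
      cross a b ≠ 0 → disc (cross a b) ≠ 0 := by
  have hφ := goldenRatio_gt
  have hφ' := goldenRatio_lt
  obtain ⟨X₀, hX₀⟩ := hU ε h0
  obtain ⟨N, hN⟩ := exists_nat_ge (max (2 * X₀) (2 * exp 60))
  obtain ⟨δ, hδ, hδN⟩ := exists_pos_le_abs_sub_mul hζ N
  refine ⟨exp (40 + 20 * |ζ| + 10 * (2 / δ)), fun h hh a b ha hb hea heb hab hdisc => ?_⟩
  have hh0 : 0 < h := (exp_pos _).trans_le hh
  have hlog : 40 + 20 * |ζ| + 10 * (2 / δ) ≤ log h := by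
    rw [Real.le_log_iff_exp_le hh0]; exact hh
  have hζ0 := abs_nonneg ζ
  have hδ0 : 0 < 2 / δ := by positivity
  set l : ℝ := 2 * exp (-(φ - ε) * log h) with hl
  have hl' : h * |quadEval ζ b| + h * |quadEval ζ a| ≤ l := by
    have := mul_exp_log (k := φ + 1 - ε) hh0
    rw [show φ + 1 - ε - 1 = φ - ε by ring] at this
    have e1 := mul_le_mul_of_nonneg_left hea hh0.le
    have e2 := mul_le_mul_of_nonneg_left heb hh0.le
    linarith
  have hn1 := (abs_cross_one_sub_le (ζ := ζ) ha hb).trans hl'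
  have hn2 := (abs_cross_two_sub_sq_le (ζ := ζ) ha hb).trans hl'
  have hl1 : l < 1 / 4 := mul_exp_neg_lt (by nlinarith)
  have hlδ : l < δ / 4 := by
    have : (2 / δ) * exp (-(φ - ε) * log h) < 1 / 4 := mul_exp_neg_lt (by nlinarith)
    rw [div_mul_eq_mul_div, div_lt_iff₀ hδ] at this
    linarith
  have hlh : (1 + |ζ|) * (h * l) < 1 / 4 := by
    have := mul_exp_log (k := φ - ε) hh0
    have h3 : (2 * (1 + |ζ|)) * exp (-(φ - ε - 1) * log h) < 1 / 4 :=
      mul_exp_neg_lt (by nlinarith)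
    rw [← this] at h3
    rw [hl]; linarith
  obtain ⟨s, t, d, hcop, hs, hd, e0, e1, e2⟩ :=
    exists_eq_sq_of_disc_eq_zero hab hdisc hn2 (by linarith)
  have hd1 : (1 : ℝ) ≤ |(d : ℝ)| := by exact_mod_cast Int.one_le_abs hd
  have hs1 : (1 : ℝ) ≤ |(s : ℝ)| := by exact_mod_cast Int.one_le_abs hs
  have hst : |(s : ℝ)| * |(t : ℝ) - ζ * s| ≤ l := by
    have : ((cross a b 1 : ℤ) : ℝ) - ζ * (cross a b 0 : ℤ) = d * (s * (t - ζ * s)) := by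
      rw [e0, e1]; push_cast; ring
    rw [this, abs_mul, abs_mul] at hn1
    nlinarith [mul_nonneg (abs_nonneg (s : ℝ)) (abs_nonneg ((t : ℝ) - ζ * s))]
  have hts : |(t : ℝ) - ζ * s| ≤ l := by
    nlinarith [abs_nonneg ((t : ℝ) - ζ * s)]
  by_cases hsN : |s| ≤ N
  · linarith [hδN s t hs hsN]
  have hsN' : (N : ℝ) < |(s : ℝ)| := by
    push Not at hsN
    exact_mod_cast hsN
  have hNX : 2 * X₀ ≤ N := (le_max_left _ _).trans hN
  have hNe : 2 * exp 60 ≤ N := (le_max_right _ _).trans hN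
  obtain ⟨c, hc, hcb, hce⟩ := hX₀ (|(s : ℝ)| / 2) (by linarith)
  have hane : a ≠ 0 := by
    rintro rfl
    exact hab (by ext i; fin_cases i <;> simp)
  have hsh : |(s : ℝ)| ≤ h := by
    have hroot : a 0 * s ^ 2 + a 1 * (s * t) + a 2 * t ^ 2 = 0 := by
      apply mul_left_cancel₀ hd
      have : a 0 * cross a b 0 + a 1 * cross a b 1 + a 2 * cross a b 2 = 0 := by simp; ring
      rw [e0, e1, e2] at this
      linear_combination this
    obtain ⟨i, hi⟩ := exists_abs_le_of_root hane hcop hs hroot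
    exact (by exact_mod_cast hi : |(s : ℝ)| ≤ |(a i : ℝ)|).trans (ha i)
  have hne : c 0 * s ^ 2 + c 1 * (s * t) + c 2 * t ^ 2 ≠ 0 := by
    intro h0
    obtain ⟨i, hi⟩ := exists_abs_le_of_root hc hcop hs h0
    have hi' : |(s : ℝ)| ≤ |(c i : ℝ)| := by exact_mod_cast hi
    linarith [hcb i]
  have hone : (1 : ℝ) ≤ |((c 0 * s ^ 2 + c 1 * (s * t) + c 2 * t ^ 2 : ℤ) : ℝ)| := by
    exact_mod_cast Int.one_le_abs hne
  rw [quadratic_form_eq ζ] at hone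
  have hx : 0 < |(s : ℝ)| / 2 := by linarith
  have hlogs : 60 ≤ log (|(s : ℝ)| / 2) := by
    rw [Real.le_log_iff_exp_le hx]; linarith
  have p1 : |(s : ℝ) ^ 2 * quadEval ζ c| < 1 / 4 := by
    have h3 : 4 * exp (-(φ + 1 - ε - 2) * log (|(s : ℝ)| / 2)) < 1 / 4 :=
      mul_exp_neg_lt (by nlinarith)
    rw [← sq_mul_exp hx] at h3
    rw [abs_mul, abs_pow]
    have := mul_le_mul_of_nonneg_left hce (sq_nonneg |(s : ℝ)|)
    nlinarith
  have ht : |(t : ℝ) + ζ * s| ≤ (2 * |ζ| + 1) * |(s : ℝ)| := by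
    have : (t : ℝ) + ζ * s = (t - ζ * s) + 2 * (ζ * s) := by ring
    rw [this]
    refine (abs_add_le _ _).trans ?_
    rw [abs_mul, abs_mul, abs_two]
    nlinarith
  have p2 : |((t : ℝ) - ζ * s) * (c 1 * s + c 2 * (t + ζ * s))| < 1 / 2 := by
    rw [abs_mul]
    have q1 : |(c 1 : ℝ) * s + c 2 * (t + ζ * s)| ≤ (1 + |ζ|) * |(s : ℝ)| * |(s : ℝ)| := by
      refine (abs_add_le _ _).trans ?_
      rw [abs_mul, abs_mul]
      have r1 := mul_le_mul (hcb 1) le_rfl (abs_nonneg (s : ℝ)) hx.le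
      have r2 := mul_le_mul (hcb 2) ht (abs_nonneg _) hx.le
      linarith
    have q2 := mul_le_mul_of_nonneg_left q1 (abs_nonneg ((t : ℝ) - ζ * s))
    have q3 : |(s : ℝ)| * (|(s : ℝ)| * |(t : ℝ) - ζ * s|) ≤ h * l :=
      mul_le_mul hsh hst (by positivity) hh0.le
    have q4 := mul_le_mul_of_nonneg_left q3 (show 0 ≤ 1 + |ζ| by linarith)
    linarith
  have := abs_add_le ((s : ℝ) ^ 2 * quadEval ζ c)
    (((t : ℝ) - ζ * s) * (c 1 * s + c 2 * (t + ζ * s)))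
  linarith

/-- `P n` minimizes the absolute value at `ζ` among nonzero quadratic integer polynomials of
height at most `n`. -/
def IsBest (ζ : ℝ) (P : ℕ → Fin 3 → ℤ) : Prop :=
  ∀ n, 1 ≤ n → P n ≠ 0 ∧ height (P n) ≤ n ∧
    ∀ b, b ≠ 0 → height b ≤ n → |quadEval ζ (P n)| ≤ |quadEval ζ b|

theorem exists_isBest (ζ : ℝ) : ∃ P, IsBest ζ P := by
  have key : ∀ n : ℕ, ∃ a : Fin 3 → ℤ, 1 ≤ n → a ≠ 0 ∧ height a ≤ n ∧
      ∀ b, b ≠ 0 → height b ≤ n → |quadEval ζ a| ≤ |quadEval ζ b| := by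
    intro n
    by_cases hn : 1 ≤ n
    · have hfin : {a : Fin 3 → ℤ | a ≠ 0 ∧ height a ≤ n}.Finite := by
        refine (Set.finite_Icc (fun _ => -(n : ℤ)) (fun _ => (n : ℤ))).subset fun a ha => ?_
        have := height_le_iff.mp ha.2
        exact ⟨fun i => (abs_le.mp (this i)).1, fun i => (abs_le.mp (this i)).2⟩
      obtain ⟨a, ha, hmin⟩ := Set.exists_min_image _ (fun a => |quadEval ζ a|) hfin
        ⟨fun _ => 1, fun h => one_ne_zero (congrFun h 0), height_le_iff.mpr fun i => by
          simpa using hn⟩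
      exact ⟨a, fun _ => ⟨ha.1, ha.2, fun b h1 h2 => hmin b ⟨h1, h2⟩⟩⟩
    · exact ⟨0, fun h => absurd h hn⟩
  choose P hP using key
  exact ⟨P, hP⟩

theorem quadEval_sub (ζ : ℝ) (a b : Fin 3 → ℤ) :
    quadEval ζ (a - b) = quadEval ζ a - quadEval ζ b := by
  simp [quadEval]; ring

theorem quadEval_neg (ζ : ℝ) (a : Fin 3 → ℤ) : quadEval ζ (-a) = -quadEval ζ a := by
  simp [quadEval]; ring

theorem eq_or_eq_neg_of_abs_quadEval_eq {ζ : ℝ} (hζ : Transcendental ℚ ζ) {a b : Fin 3 → ℤ}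
    (h : |quadEval ζ a| = |quadEval ζ b|) : a = b ∨ a = -b := by
  rcases abs_eq_abs.mp h with h | h
  · left
    by_contra hne
    exact quadEval_ne_zero hζ (sub_ne_zero.mpr hne) (by rw [quadEval_sub, h, sub_self])
  · right
    by_contra hne
    exact quadEval_ne_zero hζ (sub_ne_zero.mpr hne)
      (by rw [quadEval_sub, quadEval_neg, h, sub_self])

theorem height_neg (a : Fin 3 → ℤ) : height (-a) = height a := by
  simp [height]

theorem height_le_of_cross_eq_zero {ζ : ℝ} (hζ : Transcendental ℚ ζ) {a c : Fin 3 → ℤ}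
    (ha : a ≠ 0) (h : cross a c = 0) (hle : |quadEval ζ c| ≤ |quadEval ζ a|) :
    height c ≤ height a := by
  refine height_le_iff.mpr fun i => ?_
  have h1 := congrArg abs (mul_quadEval_of_cross_eq_zero (ζ := ζ) h i)
  rw [abs_mul, abs_mul] at h1
  have h2 : 0 < |quadEval ζ a| := abs_pos.mpr (quadEval_ne_zero hζ ha)
  have h3 : |(c i : ℝ)| ≤ |(a i : ℝ)| := by
    refine le_of_mul_le_mul_right ?_ h2
    rw [h1]
    exact mul_le_mul_of_nonneg_left hle (abs_nonneg _)
  exact_mod_cast h3.trans (abs_le_height a i)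

/-- The scalar product of two integer vectors. -/
def dot (n c : Fin 3 → ℤ) : ℤ := n 0 * c 0 + n 1 * c 1 + n 2 * c 2

theorem dot_neg (n c : Fin 3 → ℤ) : dot n (-c) = -dot n c := by
  simp [dot]; ring

theorem dot_cross_left (a b : Fin 3 → ℤ) : dot (cross a b) a = 0 := by
  simp [dot]; ring

theorem dot_cross_right (a b : Fin 3 → ℤ) : dot (cross a b) b = 0 := by
  simp [dot]; ring

theorem abs_dot_le {ζ m l h : ℝ} {z d : Fin 3 → ℤ} (h0 : |(z 0 : ℝ)| ≤ m)
    (h1 : |(z 1 : ℝ) - ζ * z 0| ≤ l) (h2 : |(z 2 : ℝ) - ζ ^ 2 * z 0| ≤ l)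
    (hd : ∀ i, |(d i : ℝ)| ≤ h) :
    |(dot z d : ℝ)| ≤ m * |quadEval ζ d| + 2 * (l * h) := by
  have hl : 0 ≤ l := (abs_nonneg _).trans h1
  have : (dot z d : ℝ) = z 0 * quadEval ζ d + (z 1 - ζ * z 0) * d 1
      + (z 2 - ζ ^ 2 * z 0) * d 2 := by
    simp [dot, quadEval]; ring
  rw [this]
  refine (abs_add_three _ _ _).trans ?_
  rw [abs_mul, abs_mul, abs_mul]
  have e1 := mul_le_mul_of_nonneg_right h0 (abs_nonneg (quadEval ζ d))
  have e2 := mul_le_mul h1 (hd 1) (abs_nonneg _) hl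
  have e3 := mul_le_mul h2 (hd 2) (abs_nonneg _) hl
  linarith

/-- Bounds the height of good approximations inside the plane spanned by `a` and `b`. -/
theorem log_le_of_plane {ζ ε g h X : ℝ} {a b c d : Fin 3 → ℤ} (hg : 0 < g) (hh : 0 < h)
    (hX : 0 < X) (ha : ∀ i, |(a i : ℝ)| ≤ g) (hb : ∀ i, |(b i : ℝ)| ≤ h)
    (hc : ∀ i, |(c i : ℝ)| ≤ X) (hd : ∀ i, |(d i : ℝ)| ≤ X)
    (hec : |quadEval ζ c| ≤ exp (-(φ + 1 - ε) * log X))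
    (hed : |quadEval ζ d| ≤ exp (-(φ + 1 - ε) * log X))
    (hdisc : disc (cross a b) ≠ 0) (hcd : cross c d ≠ 0)
    (hnc : dot (cross a b) c = 0) (hnd : dot (cross a b) d = 0) :
    (φ - ε) * log X ≤ 4 * (2 + |ζ|) + log g + log h := by
  have hl : X * |quadEval ζ d| + X * |quadEval ζ c| ≤ 2 * exp (-(φ - ε) * log X) := by
    have := mul_exp_log (k := φ + 1 - ε) hX
    rw [show φ + 1 - ε - 1 = φ - ε by ring] at this
    have e1 := mul_le_mul_of_nonneg_left hec hX.le
    have e2 := mul_le_mul_of_nonneg_left hed hX.le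
    linarith
  have h1 := one_le_of_parallel hcd hdisc (cross_mul_comm hnc hnd) (abs_cross_le ha hb)
    ((abs_cross_one_sub_le (ζ := ζ) hc hd).trans hl)
    ((abs_cross_two_sub_sq_le (ζ := ζ) hc hd).trans hl)
  have h2 : 1 ≤ (4 * (2 + |ζ|)) * exp (log g + log h + -(φ - ε) * log X) := by
    rw [exp_add, exp_add, exp_log hg, exp_log hh]
    linarith
  have := add_nonneg_of_one_le_mul_exp h2
  linarith

theorem UniformApprox.eventually_le {ζ : ℝ} (hU : UniformApprox ζ) {P : ℕ → Fin 3 → ℤ}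
    (hP : IsBest ζ P) {ε : ℝ} (h0 : 0 < ε) (h1 : ε ≤ 1) :
    ∃ n₀ : ℕ, 1 ≤ n₀ ∧ ∀ n ≥ n₀, |quadEval ζ (P n)| ≤ exp (-(φ + 1 - ε) * log (n + 1)) := by
  have hφ := goldenRatio_gt
  have hφ' := goldenRatio_lt
  obtain ⟨X₀, hX₀⟩ := hU (ε / 2) (by positivity)
  obtain ⟨N, hN⟩ := exists_nat_ge (max X₀ (exp (6 / ε)))
  refine ⟨N + 1, by omega, fun n hn => ?_⟩
  have hnN : (N : ℝ) + 1 ≤ n := by exact_mod_cast hn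
  have hn1 : (1 : ℝ) ≤ n := by
    have : (0 : ℝ) ≤ N := Nat.cast_nonneg N
    linarith
  obtain ⟨a, ha, hab, hae⟩ := hX₀ n (by linarith [(le_max_left X₀ (exp (6 / ε))).trans hN])
  refine ((hP n (by omega)).2.2 a ha (height_le_iff.mpr fun i => by exact_mod_cast hab i)).trans
    (hae.trans (exp_le_exp.mpr ?_))
  have hlog : 6 / ε ≤ log n := by
    rw [Real.le_log_iff_exp_le (by linarith)]
    linarith [(le_max_right X₀ (exp (6 / ε))).trans hN]
  rw [div_le_iff₀ h0] at hlog
  have h2 : log ((n : ℝ) + 1) ≤ log n + 1 := by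
    have h3 : log ((n : ℝ) + 1) ≤ log (2 * n) := log_le_log (by linarith) (by linarith)
    rw [log_mul (by norm_num) (by linarith)] at h3
    linarith [Real.log_two_lt_d9]
  nlinarith

section Best

variable {ζ : ℝ} {P : ℕ → Fin 3 → ℤ}

theorem IsBest.anti (hP : IsBest ζ P) {n m : ℕ} (hn : 1 ≤ n) (hnm : n ≤ m) :
    |quadEval ζ (P m)| ≤ |quadEval ζ (P n)| :=
  (hP m (hn.trans hnm)).2.2 _ (hP n hn).1 ((hP n hn).2.1.trans hnm)

theorem IsBest.lt_height (hP : IsBest ζ P) {n m : ℕ} (hn : 1 ≤ n) (hm : 1 ≤ m)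
    (h : |quadEval ζ (P m)| < |quadEval ζ (P n)|) : n < height (P m) := by
  by_contra hle
  exact absurd ((hP n hn).2.2 _ (hP m hm).1 (not_lt.mp hle)) (not_le.mpr h)

theorem IsBest.cross_ne_zero (hP : IsBest ζ P) (hζ : Transcendental ℚ ζ) {n m : ℕ} (hn : 1 ≤ n)
    (hm : 1 ≤ m) (h : |quadEval ζ (P m)| < |quadEval ζ (P n)|) : cross (P n) (P m) ≠ 0 := by
  intro h0
  have h1 := height_le_of_cross_eq_zero hζ (hP n hn).1 h0 h.le
  have h2 := hP.lt_height hn hm h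
  have h3 := (hP n hn).2.1
  omega

/-- Arbitrarily late the sequence of minimal values jumps. -/
theorem IsBest.exists_jump (hP : IsBest ζ P) (hζ : Transcendental ℚ ζ) (hU : UniformApprox ζ)
    {M : ℕ} (hM : 1 ≤ M) :
    ∃ j ≥ M, |quadEval ζ (P (j + 1))| < |quadEval ζ (P j)| := by
  by_contra! hcon
  have hconst : ∀ k, |quadEval ζ (P M)| ≤ |quadEval ζ (P (M + k))| := by
    intro k
    induction k with
    | zero => exact le_rfl
    | succ k ih => exact ih.trans (hcon (M + k) (by omega))
  have hφ := goldenRatio_gt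
  obtain ⟨n₀, -, h⟩ := hU.eventually_le hP one_pos le_rfl
  have hpos : 0 < |quadEval ζ (P M)| := abs_pos.mpr (quadEval_ne_zero hζ (hP M hM).1)
  obtain ⟨K, hK⟩ := exists_nat_ge (2 / |quadEval ζ (P M)|)
  have h1 := h (M + (n₀ + K)) (by omega)
  have h2 := hconst (n₀ + K)
  have h3 : exp (-(φ + 1 - 1) * log (((M + (n₀ + K) : ℕ) : ℝ) + 1)) ≤
      (((M + (n₀ + K) : ℕ) : ℝ) + 1)⁻¹ := by
    have hp : (0 : ℝ) < ((M + (n₀ + K) : ℕ) : ℝ) + 1 := by positivity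
    nth_rw 2 [← exp_log hp]
    rw [← exp_neg]
    apply exp_le_exp.mpr
    have : 0 ≤ log (((M + (n₀ + K) : ℕ) : ℝ) + 1) := log_nonneg (by
      linarith [(Nat.cast_nonneg (M + (n₀ + K)) : (0 : ℝ) ≤ _)])
    nlinarith
  have h4 : (((M + (n₀ + K) : ℕ) : ℝ) + 1)⁻¹ < |quadEval ζ (P M)| := by
    rw [inv_lt_comm₀ (by positivity) hpos, inv_eq_one_div]
    have : 1 / |quadEval ζ (P M)| < 2 / |quadEval ζ (P M)| := by gcongr; norm_num
    push_cast
    have e1 : (0 : ℝ) ≤ M := Nat.cast_nonneg _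
    have e2 : (0 : ℝ) ≤ n₀ := Nat.cast_nonneg _
    linarith
  linarith

/-- The exit from the plane spanned by two consecutive minimal polynomials. -/
theorem IsBest.exists_exit (hP : IsBest ζ P) (hζ : Transcendental ℚ ζ) (hU : UniformApprox ζ)
    {n : ℕ} (hn : 1 ≤ n) (hdisc : disc (cross (P n) (P (n + 1))) ≠ 0) :
    ∃ m ≥ n + 1, dot (cross (P n) (P (n + 1))) (P (m + 1)) ≠ 0 := by
  by_contra! hcon
  have hφ := goldenRatio_gt
  obtain ⟨n₀, hn₀, h⟩ := hU.eventually_le hP one_pos le_rfl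
  obtain ⟨K, hK⟩ := exists_nat_ge (exp (2 * (4 * (2 + |ζ|) + log n + log (n + 1)) + 1))
  obtain ⟨j, hj, hjump⟩ := hP.exists_jump hζ hU (M := n₀ + K + n + 2) (by omega)
  have hc0 := hcon (j - 1) (by omega)
  rw [show j - 1 + 1 = j by omega] at hc0
  have hX : (0 : ℝ) < (j : ℝ) + 1 := by positivity
  have hb : ∀ k m : ℕ, 1 ≤ k → k ≤ m → ∀ i, |(P k i : ℝ)| ≤ m := fun k m hk hkm i =>
    (abs_le_height _ i).trans (by exact_mod_cast (hP k hk).2.1.trans hkm)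
  have hej := h j (by omega)
  have hj1 := fun i => hb (j + 1) (j + 1) (by omega) le_rfl i
  have hj0 := fun i => hb j (j + 1) (by omega) (by omega) i
  have hn1 := fun i => hb (n + 1) (n + 1) (by omega) le_rfl i
  push_cast at hj1 hj0 hn1
  have := log_le_of_plane (ε := 1) (by exact_mod_cast hn) (by positivity) hX
    (hb n n hn le_rfl) hn1 hj0 hj1 hej
    (hjump.le.trans hej) hdisc (hP.cross_ne_zero hζ (by omega) (by omega) hjump)
    hc0 (hcon j (by omega))
  have hlog : 2 * (4 * (2 + |ζ|) + log n + log (n + 1)) + 1 ≤ log ((j : ℝ) + 1) := by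
    rw [Real.le_log_iff_exp_le hX]
    have : (K : ℝ) ≤ j := by exact_mod_cast (show K ≤ j by omega)
    linarith
  have hpos : 0 ≤ 4 * (2 + |ζ|) + log n + log (n + 1) := by
    have e1 : (0 : ℝ) ≤ log n := log_nonneg (by exact_mod_cast hn)
    have e2 : (0 : ℝ) ≤ log (n + 1) := log_nonneg (by
      linarith [(Nat.cast_nonneg n : (0 : ℝ) ≤ n)])
    linarith [abs_nonneg ζ]
  nlinarith

end Best

/-- Logarithmic form of the lower bound for the first of two consecutive minimal polynomials. -/
theorem log_le_of_disc_ne_zero {ζ ε g h : ℝ} {a b : Fin 3 → ℤ} (hg : 0 < g) (hh : 0 < h)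
    (hgh : g ≤ h) (ha : ∀ i, |(a i : ℝ)| ≤ g) (hb : ∀ i, |(b i : ℝ)| ≤ h)
    (hea : |quadEval ζ a| ≤ exp (-(φ + 1 - ε) * log h))
    (heb : |quadEval ζ b| ≤ |quadEval ζ a|) (hdisc : disc (cross a b) ≠ 0) :
    (φ - 1 - ε) * log h ≤ 4 * (2 + |ζ|) + log g := by
  have hl : g * |quadEval ζ b| + h * |quadEval ζ a| ≤ 2 * (h * exp (-(φ + 1 - ε) * log h)) := by
    have := mul_le_mul hgh (heb.trans hea) (abs_nonneg _) hh.le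
    have := mul_le_mul_of_nonneg_left hea hh.le
    linarith
  have h1 := abs_disc_le (abs_cross_le ha hb)
    ((abs_cross_one_sub_le (ζ := ζ) ha hb).trans hl)
    ((abs_cross_two_sub_sq_le (ζ := ζ) ha hb).trans hl)
  have h2 : (1 : ℝ) ≤ |(disc (cross a b) : ℝ)| := by
    exact_mod_cast Int.one_le_abs hdisc
  have h3 : 1 ≤ (4 * (2 + |ζ|)) * exp (log g + -(φ + 1 - ε - 2) * log h) := by
    rw [exp_add, exp_log hg, ← sq_mul_exp hh]
    refine (h2.trans h1).trans (le_of_eq ?_)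
    ring
  have := add_nonneg_of_one_le_mul_exp h3
  linarith

/-- Logarithmic form of the determinant estimate. -/
theorem log_le_of_dot_ne_zero {ζ ε g h : ℝ} {a b d : Fin 3 → ℤ} (hg : 0 < g) (hh : 0 < h)
    (hgh : g ≤ h) (ha : ∀ i, |(a i : ℝ)| ≤ g) (hb : ∀ i, |(b i : ℝ)| ≤ g)
    (hd : ∀ i, |(d i : ℝ)| ≤ h)
    (hea : |quadEval ζ a| ≤ exp (-(φ + 1 - ε) * log g))
    (heb : |quadEval ζ b| ≤ |quadEval ζ a|) (hed : |quadEval ζ d| ≤ |quadEval ζ a|)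
    (hdot : dot (cross a b) d ≠ 0) :
    (φ - ε) * log g ≤ 6 + log h := by
  have hl : g * |quadEval ζ b| + g * |quadEval ζ a| ≤ 2 * (g * |quadEval ζ a|) := by
    have := mul_le_mul_of_nonneg_left heb hg.le
    linarith
  have h1 := abs_dot_le (abs_cross_le ha hb 0)
    ((abs_cross_one_sub_le (ζ := ζ) ha hb).trans hl)
    ((abs_cross_two_sub_sq_le (ζ := ζ) ha hb).trans hl) hd
  have h2 : (1 : ℝ) ≤ |(dot (cross a b) d : ℝ)| := by
    exact_mod_cast Int.one_le_abs hdot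
  have h3 : 1 ≤ 6 * exp (log h + -(φ + 1 - ε - 1) * log g) := by
    rw [exp_add, exp_log hh, ← mul_exp_log hg]
    refine (h2.trans h1).trans ?_
    have e1 : g * |quadEval ζ d| ≤ h * |quadEval ζ a| :=
      mul_le_mul hgh hed (abs_nonneg _) hh.le
    have e2 := mul_le_mul_of_nonneg_left e1 hg.le
    have e3 := mul_le_mul_of_nonneg_left hea (mul_pos hg hh).le
    nlinarith
  have := add_nonneg_of_one_le_mul_exp h3
  linarith

theorem abs_le_of_height_le {a : Fin 3 → ℤ} {h : ℝ} (ha : (height a : ℝ) ≤ h) (i : Fin 3) :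
    |(a i : ℝ)| ≤ h := (abs_le_height a i).trans ha

section Subsequence

variable {ζ : ℝ} {P : ℕ → Fin 3 → ℤ}

theorem IsBest.cross_succ_ne_zero (hP : IsBest ζ P) (hζ : Transcendental ℚ ζ) {n : ℕ}
    (hn : 1 ≤ n) (h : |quadEval ζ (P (n + 1))| < |quadEval ζ (P n)|) :
    cross (P n) (P (n + 1)) ≠ 0 := hP.cross_ne_zero hζ hn (by omega) h

theorem IsBest.eval_lt_of_lt_height (hP : IsBest ζ P) (hζ : Transcendental ℚ ζ) {k m : ℕ}
    (hk : 1 ≤ k) (hm : 1 ≤ m) (h : k < height (P m)) :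
    |quadEval ζ (P m)| < |quadEval ζ (P k)| := by
  have hkm : k ≤ m := h.le.trans (hP m hm).2.1
  refine lt_of_le_of_ne (hP.anti hk hkm) fun heq => ?_
  have h2 := (hP k hk).2.1
  rcases eq_or_eq_neg_of_abs_quadEval_eq hζ heq with h1 | h1
  · rw [h1] at h; omega
  · rw [h1, height_neg] at h; omega

theorem step_arith {p e c x h y z : ℝ} (hp : 1.618 < p) (hp' : p < 1.6181) (hpp : p * p = p + 1)
    (he : 0 < e) (he' : e ≤ 1 / 20) (hc : 8 ≤ c) (hx : c / e ≤ x) (hxy : x ≤ y)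
    (h1 : (p - 1 - e) * h ≤ c + x)
    (h2 : (p - e) * y ≤ c + x + h) (h3 : (p - e) * y ≤ 6 + z) :
    y ≤ (p + 20 * e) * x ∧ (2 * p + 1 - 20 * e) * y ≤ (p + 1 - e) * z := by
  have hx' : c ≤ e * x := by rwa [div_le_iff₀ he, mul_comm] at hx
  have hx0 : 0 < x := by nlinarith
  have hey : e * x ≤ e * y := by nlinarith
  constructor
  · have h4 : (p - e) * ((p - 1 - e) * y) ≤ (p - e) * (2 * c + x) := by
      have := mul_le_mul_of_nonneg_left h2 (show 0 ≤ p - 1 - e by linarith)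
      nlinarith
    have h5 : (p - 1 - e) * y ≤ 2 * c + x := le_of_mul_le_mul_left h4 (by linarith)
    have h6 : (p - 1 - e) * y ≤ (p - 1 - e) * ((p + 20 * e) * x) := by
      refine h5.trans ?_
      have : (p - 1 - e) * ((p + 20 * e) * x) = (p * p - p) * x
        + (20 * (p - 1) - p - 20 * e) * (e * x) := by ring
      rw [this, hpp]
      nlinarith
    exact le_of_mul_le_mul_left h6 (by linarith)
  · have h4 := mul_le_mul_of_nonneg_left h3 (show 0 ≤ p + 1 - e by linarith)
    have h5 : (p + 1 - e) * ((p - e) * y) = (p * p + p - e * (2 * p + 1) + e * e) * y := by ring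
    rw [h5, hpp] at h4
    have : 0 ≤ e * (e * y) := by nlinarith [mul_pos he (hx0.trans_le hxy)]
    nlinarith

/-- One step in the construction of the sequence of polynomials. -/
theorem IsBest.exists_step (hP : IsBest ζ P) (hζ : Transcendental ℚ ζ) (hU : UniformApprox ζ)
    {ε : ℝ} (h0 : 0 < ε) (h1 : ε ≤ 1) :
    ∃ n₀ : ℕ, 1 ≤ n₀ ∧ ∀ n ≥ n₀, |quadEval ζ (P (n + 1))| < |quadEval ζ (P n)| →
      ∃ m ≥ n + 1, |quadEval ζ (P (m + 1))| < |quadEval ζ (P m)| ∧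
        n < height (P m) ∧ disc (cross (P n) (P m)) ≠ 0 ∧
        log (height (P m)) ≤ (φ + ε) * log (height (P n)) ∧
        |quadEval ζ (P m)| ≤ exp (-(2 * φ + 1 - ε) * log (height (P m))) := by
  have hφ := goldenRatio_gt
  have hφ' := goldenRatio_lt
  have hφφ := goldenRatio_mul_self
  obtain ⟨e, rfl⟩ : ∃ e, ε = 20 * e := ⟨ε / 20, by ring⟩
  have he : 0 < e := by linarith
  have he' : e ≤ 1 / 20 := by linarith
  obtain ⟨n₀, hn₀, hev⟩ := hU.eventually_le hP he (by linarith)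
  obtain ⟨H₀, hH₀⟩ := disc_cross_ne_zero hζ hU he (by linarith)
  set c := 4 * (2 + |ζ|) with hc
  have hc8 : 8 ≤ c := by have := abs_nonneg ζ; linarith
  obtain ⟨N, hN⟩ := exists_nat_ge (max H₀ (exp (4 * (c / e))))
  refine ⟨n₀ + N + 1, by omega, fun n hn hjump => ?_⟩
  have hn1 : 1 ≤ n := by omega
  have hnN : (N : ℝ) ≤ n := by exact_mod_cast (show N ≤ n by omega)
  have hbn := hP n hn1
  have hbn1 := hP (n + 1) (by omega)
  have hevn := hev n (by omega)
  set h : ℝ := (n : ℝ) + 1 with hh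
  have hh0 : 0 < h := by positivity
  have hgn : 0 < (height (P n) : ℝ) := by exact_mod_cast height_pos hbn.1
  have hgnh : (height (P n) : ℝ) ≤ h := by
    have : (height (P n) : ℝ) ≤ n := by exact_mod_cast hbn.2.1
    linarith
  have hbn1h : (height (P (n + 1)) : ℝ) ≤ h := by rw [hh]; exact_mod_cast hbn1.2.1
  have hdisc : disc (cross (P n) (P (n + 1))) ≠ 0 :=
    hH₀ h (by have := (le_max_left _ _).trans hN; linarith) _ _ (abs_le_of_height_le hgnh)
      (abs_le_of_height_le hbn1h) hevn (hjump.le.trans hevn) (hP.cross_succ_ne_zero hζ hn1 hjump)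
  have L4 := log_le_of_disc_ne_zero hgn hh0 hgnh (abs_le_height _) (abs_le_of_height_le hbn1h)
    hevn hjump.le hdisc
  -- the first index at which the sequence leaves the plane
  have hex := hP.exists_exit hζ hU hn1 hdisc
  classical
  set m := Nat.find hex with hm
  obtain ⟨hmn, hmdot⟩ := Nat.find_spec hex
  rw [← hm] at hmn hmdot
  have hplane : ∀ k, n ≤ k → k ≤ m → dot (cross (P n) (P (n + 1))) (P k) = 0 := by
    intro k hk hkm
    rcases Nat.eq_or_lt_of_le hk with rfl | hk
    · exact dot_cross_left _ _
    rcases Nat.eq_or_lt_of_le (Nat.succ_le_of_lt hk) with rfl | hk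
    · exact dot_cross_right _ _
    have := Nat.find_min hex (m := k - 1) (by omega)
    by_contra hne
    exact this ⟨by omega, by rwa [show k - 1 + 1 = k by omega]⟩
  have hm1 : 1 ≤ m := by omega
  have hbm := hP m hm1
  have hmjump : |quadEval ζ (P (m + 1))| < |quadEval ζ (P m)| := by
    refine lt_of_le_of_ne (hP.anti hm1 (by omega)) fun heq => hmdot ?_
    rcases eq_or_eq_neg_of_abs_quadEval_eq hζ heq with h | h
    · rw [h]; exact hplane m (by omega) le_rfl
    · rw [h, dot_neg, hplane m (by omega) le_rfl, neg_zero]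
  have hmn' : |quadEval ζ (P m)| < |quadEval ζ (P n)| :=
    (hP.anti (by omega) hmn).trans_lt hjump
  have hlt : n < height (P m) := hP.lt_height hn1 hm1 hmn'
  set q := height (P m) with hq
  have hqm : q ≤ m := hbm.2.1
  have hW1 : 1 ≤ q - 1 := by omega
  have hWlt := hP.eval_lt_of_lt_height hζ hW1 hm1 (show q - 1 < q by omega)
  have hevW := hev (q - 1) (by omega)
  have hcast : ((q - 1 : ℕ) : ℝ) + 1 = q := by
    exact_mod_cast (show q - 1 + 1 = q by omega)
  rw [hcast] at hevW
  have hq0 : (0 : ℝ) < q := by exact_mod_cast (show 0 < q by omega)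
  have hWq : (height (P (q - 1)) : ℝ) ≤ q := by
    exact_mod_cast (hP (q - 1) hW1).2.1.trans (by omega)
  have hcW := hP.cross_ne_zero hζ hW1 hm1 hWlt
  have hdW := hplane (q - 1) (by omega) (by omega)
  have hdm := hplane m (by omega) le_rfl
  have L5 := log_le_of_plane hgn hh0 hq0 (abs_le_height _) (abs_le_of_height_le hbn1h)
    (abs_le_of_height_le hWq) (abs_le_of_height_le le_rfl) hevW (hWlt.le.trans hevW)
    hdisc hcW hdW hdm
  have hm0 : (0 : ℝ) < (m : ℝ) + 1 := by positivity
  have hm1q : (height (P (m + 1)) : ℝ) ≤ (m : ℝ) + 1 := by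
    exact_mod_cast (hP (m + 1) (by omega)).2.1
  have hdet : dot (cross (P (q - 1)) (P m)) (P (m + 1)) ≠ 0 := by
    intro hz
    have hpar := cross_mul_comm hdW hdm
    obtain ⟨i, hi⟩ := Function.ne_iff.mp hcW
    apply hmdot
    have : cross (P (q - 1)) (P m) i * dot (cross (P n) (P (n + 1))) (P (m + 1)) = 0 := by
      unfold dot at hz ⊢
      linear_combination (cross (P n) (P (n + 1)) i) * hz
        + P (m + 1) 0 * hpar i 0 + P (m + 1) 1 * hpar i 1 + P (m + 1) 2 * hpar i 2
    exact (mul_eq_zero.mp this).resolve_left hi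
  have Ldet := log_le_of_dot_ne_zero hq0 hm0
    (by exact_mod_cast (show q ≤ m + 1 by omega)) (abs_le_of_height_le hWq)
    (abs_le_of_height_le le_rfl) (abs_le_of_height_le hm1q) hevW hWlt.le
    ((hP.anti hm1 (Nat.le_succ m)).trans hWlt.le) hdet
  have hlogh : 4 * (c / e) ≤ log h := by
    rw [le_log_iff_exp_le hh0]
    have := (le_max_right _ _).trans hN
    linarith
  have hx : c / e ≤ log (height (P n)) := by
    have h5 : c ≤ c / e := by rw [le_div_iff₀ he]; nlinarith
    nlinarith
  have hxy : log (height (P n)) ≤ log q := by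
    refine log_le_log hgn ?_
    exact_mod_cast hbn.2.1.trans hlt.le
  obtain ⟨r1, r2⟩ := step_arith hφ hφ' hφφ he he' hc8 hx hxy L4 L5 Ldet
  refine ⟨m, hmn, hmjump, hlt, ?_, r1, (hev m (by omega)).trans (exp_le_exp.mpr (by linarith))⟩
  exact disc_ne_zero_of_parallel (hP.cross_ne_zero hζ hn1 hm1 hmn') hdisc
    (cross_mul_comm (dot_cross_left _ _) hdm)

/-- The sequence of quadratic polynomials attached to an extremal number. -/
theorem exists_seq (hζ : Transcendental ℚ ζ) (hU : UniformApprox ζ) {ε : ℝ} (h0 : 0 < ε)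
    (h1 : ε ≤ 1) (B : ℝ) :
    ∃ (a : ℕ → Fin 3 → ℤ) (G : ℕ → ℝ), (∀ k i, |(a k i : ℝ)| ≤ exp (G k)) ∧
      (∀ k, |quadEval ζ (a k)| ≤ exp (-(2 * φ + 1 - ε) * G k)) ∧
      (∀ k, G k < G (k + 1)) ∧ (∀ k, G (k + 1) ≤ (φ + ε) * G k) ∧
      (∀ k, disc (cross (a k) (a (k + 1))) ≠ 0) ∧ B ≤ G 0 ∧ ∀ Y, ∃ k, Y < G k := by
  obtain ⟨P, hP⟩ := exists_isBest ζ
  obtain ⟨n₀, hn₀, hstep⟩ := hP.exists_step hζ hU h0 h1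
  obtain ⟨N, hN⟩ := exists_nat_ge (exp B)
  obtain ⟨j, hj, hjump⟩ := hP.exists_jump hζ hU (M := n₀ + N + 1) (by omega)
  let S := {n : ℕ // n₀ + N + 1 ≤ n ∧ |quadEval ζ (P (n + 1))| < |quadEval ζ (P n)|}
  have hstep' : ∀ n : S, ∃ m : S, n.1 < height (P m.1) ∧
      disc (cross (P n.1) (P m.1)) ≠ 0 ∧
        log (height (P m.1)) ≤ (φ + ε) * log (height (P n.1)) ∧
        |quadEval ζ (P m.1)| ≤ exp (-(2 * φ + 1 - ε) * log (height (P m.1))) := by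
    rintro ⟨n, hn, hnj⟩
    obtain ⟨m, hm, hmj, h⟩ := hstep n (by omega) hnj
    exact ⟨⟨m, by omega, hmj⟩, h⟩
  choose f hf using hstep'
  let s : ℕ → S := fun k => f^[k + 1] ⟨j, hj, hjump⟩
  have hs : ∀ k, s (k + 1) = f (s k) := fun k => Function.iterate_succ_apply' f (k + 1) _
  have hs0 : ∀ k, ∃ n : S, s k = f n := fun k => ⟨_, Function.iterate_succ_apply' f k _⟩
  have hpos : ∀ k, n₀ + N + 1 < height (P (s k).1) := by
    intro k
    obtain ⟨n, hn⟩ := hs0 k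
    rw [hn]
    exact lt_of_le_of_lt n.2.1 (hf n).1
  have hpos' : ∀ k, (0 : ℝ) < height (P (s k).1) := fun k => by
    have := hpos k
    exact_mod_cast (show 0 < height (P (s k).1) by omega)
  have hlt : ∀ k, height (P (s k).1) < height (P (s (k + 1)).1) := by
    intro k
    rw [hs]
    refine lt_of_le_of_lt ?_ (hf (s k)).1
    exact (hP _ (by have := (s k).2.1; omega)).2.1
  refine ⟨fun k => P (s k).1, fun k => log (height (P (s k).1)), fun k i => ?_, fun k => ?_,
    fun k => ?_, fun k => ?_, fun k => ?_, ?_, fun Y => ?_⟩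
  · rw [exp_log (hpos' k)]; exact abs_le_height _ i
  · obtain ⟨n, hn⟩ := hs0 k
    simp only [hn]
    exact (hf n).2.2.2
  · exact log_lt_log (hpos' k) (by exact_mod_cast hlt k)
  · simp only [hs]
    exact (hf (s k)).2.2.1
  · simp only [hs]
    exact (hf (s k)).2.1
  · rw [le_log_iff_exp_le (hpos' 0)]
    refine hN.trans ?_
    have := hpos 0
    exact_mod_cast (show N ≤ height (P (s 0).1) by omega)
  · obtain ⟨k, hk⟩ := exists_nat_gt (exp Y)
    refine ⟨k, ?_⟩
    rw [lt_log_iff_exp_lt (hpos' k)]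
    refine hk.trans_le ?_
    exact_mod_cast (strictMono_nat_of_lt_succ hlt).le_apply

theorem exists_index_between {G : ℕ → ℝ} (hG : ∀ Y, ∃ k, Y < G k) {Y : ℝ} (hY : G 0 ≤ Y) :
    ∃ k, G k ≤ Y ∧ Y < G (k + 1) := by
  classical
  have hspec := Nat.find_spec (hG Y)
  have hmin := fun k => Nat.find_min (hG Y) (m := k)
  set k := Nat.find (hG Y)
  have hk : k ≠ 0 := fun h => by rw [h] at hspec; linarith
  refine ⟨k - 1, not_lt.mp (hmin _ (by omega)), ?_⟩
  rwa [show k - 1 + 1 = k by omega]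

end Subsequence

theorem abs_coeff_le_polyH (P : Polynomial ℤ) (i : ℕ) : |(P.coeff i : ℝ)| ≤ polyH P := by
  have h : (P.coeff i).natAbs ≤ P.support.sup fun i => (P.coeff i).natAbs := by
    by_cases hi : i ∈ P.support
    · exact Finset.le_sup (f := fun i => (P.coeff i).natAbs) hi
    · simp [Polynomial.notMem_support_iff.mp hi]
  rw [← Int.cast_abs, ← Nat.cast_natAbs]
  exact Nat.cast_le.mpr h

theorem polyH_le {P : Polynomial ℤ} {X : ℝ} (hX : 0 ≤ X) (h : ∀ i, |(P.coeff i : ℝ)| ≤ X) :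
    polyH P ≤ X := by
  have : (P.support.sup fun i => (P.coeff i).natAbs) ≤ ⌊X⌋₊ := by
    refine Finset.sup_le fun i _ => Nat.le_floor ?_
    have := h i
    rwa [← Int.cast_abs, ← Nat.cast_natAbs] at this
  exact (Nat.cast_le.mpr this).trans (Nat.floor_le hX)

theorem goldenRatio_add_one : φ + 1 = (3 + √5) / 2 := by
  unfold Real.goldenRatio; ring

theorem _root_.IsExtremal.uniformApprox {ζ : ℝ} (h : IsExtremal ζ) : UniformApprox ζ := by
  intro ε hε
  have hφ := goldenRatio_gt
  have hsup : sSup (whSet 2 ζ) = φ + 1 := h.2.trans goldenRatio_add_one.symm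
  have hne : (whSet 2 ζ).Nonempty := by
    rw [Set.nonempty_iff_ne_empty]
    intro h0
    rw [h0, Real.sSup_empty] at hsup
    linarith
  obtain ⟨η, ⟨X₀, hX₀⟩, hη⟩ := exists_lt_of_lt_csSup hne
    (show φ + 1 - ε < sSup (whSet 2 ζ) by rw [hsup]; linarith)
  refine ⟨max X₀ 1, fun X hX => ?_⟩
  obtain ⟨P, hdeg, hH, hpos, hle⟩ := hX₀ X ((le_max_left _ _).trans hX)
  have hX1 : 1 ≤ X := (le_max_right _ _).trans hX
  have hev : quadEval ζ (fun i => P.coeff i) = pev ζ P := by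
    unfold pev quadEval
    rw [Polynomial.aeval_eq_sum_range' (show P.natDegree < 3 by omega)]
    simp [Finset.sum_range_succ]
  refine ⟨fun i => P.coeff i, fun h0 => ?_, fun i => (abs_coeff_le_polyH P i).trans hH, ?_⟩
  · rw [h0] at hev
    rw [← hev] at hpos
    simp [quadEval] at hpos
  · rw [hev]
    refine hle.trans ?_
    rw [rpow_def_of_pos (by linarith)]
    refine exp_le_exp.mpr ?_
    have := log_nonneg hX1
    nlinarith

theorem four_le_exp_two : (4 : ℝ) ≤ exp 2 := by
  have h1 : exp 2 = exp 1 * exp 1 := by rw [← exp_add]; norm_num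
  have := exp_one_gt_d9
  rw [h1]; nlinarith

theorem descent_arith {p e C U V Y M : ℝ} (hp : 1.618 < p) (hp' : p < 1.6181)
    (hpp : p * p = p + 1) (he : 0 < e) (he' : 40 * e ≤ 1) (hC : 4 ≤ C)
    (hM : 120 * (C + 2) ≤ 40 * e * M) (hY : (p + 1 - 3 * e) * Y = M) (hYU : Y ≤ U)
    (hU : U ≤ (p + e) * Y) (hV : V ≤ (p + e) * U) :
    V - (2 * p + 1 - e) * U + M ≤ -(e / 3) * M ∧ 2 + (U + V - (1 + 40 * e) * M) < M ∧
      C + (V - (2 * p + 1 - e) * U + M) + (1 + 40 * e) * (2 + (U + V - (1 + 40 * e) * M)) < 0 := by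
  have hM0 : 720 ≤ M := by nlinarith
  have hY0 : 0 < Y := by nlinarith
  have hUM : U ≤ 0.6466 * M := by
    have : U ≤ 1.6431 * Y := by nlinarith
    have : 2.543 * Y ≤ M := by nlinarith
    linarith
  have hU0 : 0 < U := by linarith
  have hVU : V ≤ 1.6431 * U := by nlinarith
  have heU : 0 < e * U := mul_pos he hU0
  have heM : 0 < e * M := mul_pos he (by linarith)
  have heUM : e * U ≤ e * (0.6466 * M) := mul_le_mul_of_nonneg_left hUM he.le
  have hV' : V - (2 * p + 1 - e) * U ≤ -(p + 1) * U + 2 * (e * U) := by linarith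
  refine ⟨?_, by nlinarith, ?_⟩
  · have h1 : (p + 1 - 2 * e) * Y ≤ (p + 1 - 2 * e) * U :=
      mul_le_mul_of_nonneg_left hYU (by linarith)
    have h2 : M ≤ 2.6181 * Y := by nlinarith
    have h3 : e * M ≤ e * (2.6181 * Y) := mul_le_mul_of_nonneg_left h2 he.le
    nlinarith
  · have h4 : U + V ≤ (p + 1) * U + e * U := by linarith
    have h5 := mul_le_mul_of_nonneg_left h4 (show 0 ≤ 1 + 40 * e by linarith)
    have h6 : e * (e * U) ≤ e * U := by nlinarith
    have h7 : p * (e * U) ≤ 1.6181 * (e * U) := by nlinarith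
    have h8 : 0 ≤ e * (e * M) := by positivity
    nlinarith

set_option maxHeartbeats 400000 in
/-- A very good rational approximation to `ζ` gives rise to another one of smaller height. -/
theorem exists_descent {ζ : ℝ} (hζ : Transcendental ℚ ζ) (hU : UniformApprox ζ) {δ : ℝ}
    (h0 : 0 < δ) (h1 : δ ≤ 1) :
    ∃ M₀ : ℝ, ∀ s t : ℤ, M₀ ≤ log |(s : ℝ)| → ∀ b ≥ 0,
      |(t : ℝ) - ζ * s| < exp (-b - (1 + δ) * log |(s : ℝ)|) →
      ∃ u v : ℤ, u ≠ 0 ∧ |u| < |s| ∧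
        |(v : ℝ) - ζ * u| < exp (-b - (1 + δ) * log |(u : ℝ)|) := by
  have hφ := goldenRatio_gt
  have hφ' := goldenRatio_lt
  have hφφ := goldenRatio_mul_self
  obtain ⟨e, rfl⟩ : ∃ e, δ = 40 * e := ⟨δ / 40, by ring⟩
  have he : 0 < e := by linarith
  obtain ⟨a, G, ha, hev, hlt, hle, hdisc, hG0, hGtop⟩ := exists_seq hζ hU he (by linarith) 0
  set C := 4 + 4 * |ζ| with hC
  have hC4 : 4 ≤ C := by have := abs_nonneg ζ; linarith
  refine ⟨max (3 * G 0) (120 * (C + 2) / (40 * e)), fun s t hM b hb hst => ?_⟩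
  set M := log |(s : ℝ)| with hMdef
  have hM1 : 3 * G 0 ≤ M := (le_max_left _ _).trans hM
  have hM2 : 120 * (C + 2) ≤ 40 * e * M := by
    have := (le_max_right _ _).trans hM
    rw [div_le_iff₀ h0] at this
    linarith
  have hMpos : 0 < M := by
    by_contra hneg
    nlinarith
  have hs : s ≠ 0 := by
    rintro rfl
    simp [hMdef] at hMpos
  have hsM : |(s : ℝ)| = exp M := (exp_log (by positivity)).symm
  obtain ⟨Y, hY⟩ : ∃ Y, (φ + 1 - 3 * e) * Y = M :=
    ⟨M / (φ + 1 - 3 * e), mul_div_cancel₀ _ (by linarith)⟩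
  have hY0 : G 0 ≤ Y := by nlinarith
  obtain ⟨j, hj1, hj2⟩ := exists_index_between hGtop hY0
  set U := G (j + 1) with hUdef
  set V := G (j + 2) with hVdef
  have hUV : U < V := hlt (j + 1)
  have hUY : U ≤ (φ + e) * Y := (hle j).trans (by nlinarith)
  have hVU : V ≤ (φ + e) * U := hle (j + 1)
  obtain ⟨i1, i2, i3⟩ := descent_arith hφ hφ' hφφ he h1 hC4 hM2 hY hj2.le hUY hVU
  set y := cross (a (j + 1)) (a (j + 2)) with hy
  have hydisc : disc y ≠ 0 := hdisc (j + 1)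
  set L := 2 * exp (V - (2 * φ + 1 - e) * U) with hL
  have hL0 : 0 < L := by positivity
  have hbound : exp U * |quadEval ζ (a (j + 2))| + exp V * |quadEval ζ (a (j + 1))| ≤ L := by
    have e1 : exp U * |quadEval ζ (a (j + 2))| ≤ exp (V - (2 * φ + 1 - e) * U) := by
      refine (mul_le_mul_of_nonneg_left (hev (j + 2)) (exp_pos _).le).trans ?_
      rw [← exp_add]
      refine exp_le_exp.mpr ?_
      nlinarith
    have e2 : exp V * |quadEval ζ (a (j + 1))| ≤ exp (V - (2 * φ + 1 - e) * U) := by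
      refine (mul_le_mul_of_nonneg_left (hev (j + 1)) (exp_pos _).le).trans ?_
      rw [← exp_add]
      refine exp_le_exp.mpr ?_
      linarith
    linarith
  have hy0 := abs_cross_le (ha (j + 1)) (ha (j + 2)) 0
  have hy1 := (abs_cross_one_sub_le (ζ := ζ) (ha (j + 1)) (ha (j + 2))).trans hbound
  have hy2 := abs_two_sub_le hy1
    ((abs_cross_two_sub_sq_le (ζ := ζ) (ha (j + 1)) (ha (j + 2))).trans hbound)
  rw [← hy] at hy0 hy1 hy2
  set l := |(t : ℝ) - ζ * s| with hl
  have hl1 : l ≤ exp M := hst.le.trans (exp_le_exp.mpr (by nlinarith))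
  have hLM : C / 2 * (L * exp M) = C * exp (V - (2 * φ + 1 - e) * U + M) := by
    rw [exp_add]; ring
  have hquart : C / 2 * (L * exp M) < 1 / 4 := by
    rw [hLM]
    refine lt_of_le_of_lt ?_ (mul_exp_neg_lt (C := C) (k := e / 3) (L := M) (by nlinarith))
    gcongr
  set u : ℤ := y 0 * t - y 1 * s with hu
  set v : ℤ := y 1 * t - y 2 * s with hv
  have hvu : |(v : ℝ) - ζ * u| ≤ C / 2 * (L * exp M) := by
    have : (v : ℝ) - ζ * u = (y 1 - ζ * y 0) * (t - ζ * s) + ζ * (y 1 - ζ * y 0) * s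
        - (y 2 - ζ * y 1) * s := by
      rw [hv, hu]; push_cast; ring
    rw [this]
    refine (abs_sub _ _).trans ((add_le_add_left (abs_add_le _ _) _).trans ?_)
    simp only [abs_mul, hsM]
    have e1 := mul_le_mul hy1 hl1 (abs_nonneg _) hL0.le
    have e2 := mul_le_mul_of_nonneg_left hy1 (mul_nonneg (abs_nonneg ζ) (exp_pos M).le)
    have e3 := mul_le_mul_of_nonneg_right hy2 (exp_pos M).le
    have e4 : C / 2 * (L * exp M) = L * exp M + |ζ| * exp M * L + (1 + |ζ|) * L * exp M := by
      rw [hC]; ring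
    linarith
  have hLq : L * exp M ≤ 1 / 4 := by
    have : 0 < L * exp M := by positivity
    nlinarith
  have huu : |(u : ℝ)| ≤ 2 * exp (U + V) * l + 1 / 4 := by
    have : (u : ℝ) = y 0 * (t - ζ * s) - (y 1 - ζ * y 0) * s := by
      rw [hu]; push_cast; ring
    rw [this]
    refine (abs_sub _ _).trans ?_
    simp only [abs_mul, hsM]
    have e1 := mul_le_mul_of_nonneg_right hy0 (abs_nonneg ((t : ℝ) - ζ * s))
    have e2 := mul_le_mul_of_nonneg_right hy1 (exp_pos M).le
    rw [← exp_add] at e1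
    linarith
  have hu0 : u ≠ 0 := by
    intro hu0
    have hv0 : v = 0 := by
      rw [hu0] at hvu
      have : |(v : ℝ)| < 1 := by
        have h5 : (v : ℝ) - ζ * ((0 : ℤ) : ℝ) = v := by simp
        rw [h5] at hvu
        linarith
      exact Int.abs_lt_one_iff.mp (by exact_mod_cast this)
    apply hydisc
    have : disc y * s ^ 2 = 0 := by
      unfold disc
      linear_combination (-y 1 * s) * hu0 + y 0 * s * hv0 + (y 1 * s) * hu - (y 0 * s) * hv
    exact (mul_eq_zero.mp this).resolve_right (pow_ne_zero 2 hs)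
  have hu1 : (1 : ℝ) ≤ |(u : ℝ)| := by exact_mod_cast Int.one_le_abs hu0
  have hlogu : log |(u : ℝ)| ≤ 2 + (U + V - b - (1 + 40 * e) * M) := by
    rw [log_le_iff_le_exp (by linarith)]
    have e1 := mul_le_mul_of_nonneg_left hst.le (exp_pos (U + V)).le
    rw [← exp_add] at e1
    have e2 : |(u : ℝ)| ≤ 4 * exp (U + V + (-b - (1 + 40 * e) * M)) := by linarith
    refine e2.trans ?_
    rw [exp_add 2, show U + V - b - (1 + 40 * e) * M = U + V + (-b - (1 + 40 * e) * M) by ring]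
    exact mul_le_mul_of_nonneg_right four_le_exp_two (exp_pos _).le
  refine ⟨u, v, hu0, ?_, hvu.trans_lt ?_⟩
  · have : log |(u : ℝ)| < log |(s : ℝ)| := by linarith
    have := (log_lt_log_iff (by linarith) (by positivity)).mp this
    exact_mod_cast this
  · rw [hLM]
    refine (mul_exp_le_exp le_rfl).trans_lt (exp_lt_exp.mpr ?_)
    have := mul_le_mul_of_nonneg_left hlogu (show 0 ≤ 1 + 40 * e by linarith)
    have h5 : 0 ≤ 40 * e * b := mul_nonneg h0.le hb
    linarith

/-- An extremal number is badly approximable up to an arbitrarily small exponent. -/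
theorem exists_rational_bound {ζ : ℝ} (hζ : Transcendental ℚ ζ) (hU : UniformApprox ζ) {δ : ℝ}
    (h0 : 0 < δ) (h1 : δ ≤ 1) :
    ∃ b ≥ 0, ∀ s t : ℤ, s ≠ 0 → exp (-b - (1 + δ) * log |(s : ℝ)|) ≤ |(t : ℝ) - ζ * s| := by
  obtain ⟨M₀, hM₀⟩ := exists_descent hζ hU h0 h1
  obtain ⟨N, hN⟩ := exists_nat_ge (exp M₀)
  obtain ⟨c, hc, hcN⟩ := exists_pos_le_abs_sub_mul hζ N
  refine ⟨max 0 (-log c), le_max_left _ _, fun s t hs => ?_⟩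
  induction hn : s.natAbs using Nat.strong_induction_on generalizing s t with
  | _ n ih =>
    by_cases hsN : |s| ≤ N
    · refine le_trans ?_ (hcN s t hs hsN)
      rw [← le_log_iff_exp_le hc]
      have h2 : 0 ≤ log |(s : ℝ)| := log_nonneg (by exact_mod_cast Int.one_le_abs hs)
      have := le_max_right 0 (-log c)
      nlinarith
    · by_contra! hcon
      obtain ⟨u, v, hu, hus, huv⟩ := hM₀ s t (by
        rw [le_log_iff_exp_le (by positivity)]
        refine hN.trans ?_
        exact_mod_cast (not_le.mp hsN).le) _ (le_max_left _ _) hcon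
      rw [Int.abs_eq_natAbs, Int.abs_eq_natAbs] at hus
      exact absurd (ih u.natAbs (by omega) u v hu rfl) (not_le.mpr huv)

/-- Two consecutive members of the sequence of polynomials attached to an extremal number,
with coefficients of size at most `exp U` and `exp V`. -/
structure GoodPair (ζ ε : ℝ) (a b : Fin 3 → ℤ) (U V : ℝ) : Prop where
  abs_left_le : ∀ i, |(a i : ℝ)| ≤ exp U
  abs_right_le : ∀ i, |(b i : ℝ)| ≤ exp V
  eval_left_le : |quadEval ζ a| ≤ exp (-(2 * φ + 1 - ε) * U)
  eval_right_le : |quadEval ζ b| ≤ exp (-(2 * φ + 1 - ε) * V)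
  nonneg : 0 ≤ U
  lt : U < V
  le_mul : V ≤ (φ + ε) * U
  disc_ne_zero : disc (cross a b) ≠ 0

theorem exists_goodPair {ζ : ℝ} (hζ : Transcendental ℚ ζ) (hU : UniformApprox ζ) {ε : ℝ}
    (h0 : 0 < ε) (h1 : ε ≤ 1) :
    ∃ Y₀ : ℝ, ∀ Y ≥ Y₀, ∃ (a b : Fin 3 → ℤ) (U V : ℝ), GoodPair ζ ε a b U V ∧ U ≤ Y ∧ Y < V := by
  obtain ⟨a, G, ha, hev, hlt, hle, hdisc, hG0, hGtop⟩ := exists_seq hζ hU h0 h1 0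
  refine ⟨G 0, fun Y hY => ?_⟩
  obtain ⟨k, hk1, hk2⟩ := exists_index_between hGtop hY
  exact ⟨a k, a (k + 1), G k, G (k + 1), ⟨ha k, ha (k + 1), hev k, hev (k + 1),
    hG0.trans ((strictMono_nat_of_lt_succ hlt).monotone (Nat.zero_le k)), hlt k, hle k, hdisc k⟩,
    hk1, hk2⟩

/-- Value at `ζ` of the polynomial of degree at most three with coefficient vector `p`. -/
def cubicEval (ζ : ℝ) (p : Fin 4 → ℤ) : ℝ := p 0 + p 1 * ζ + p 2 * ζ ^ 2 + p 3 * ζ ^ 3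

/-- The coefficient vector of a quadratic polynomial, as a cubic polynomial. -/
def incl (a : Fin 3 → ℤ) : Fin 4 → ℤ := ![a 0, a 1, a 2, 0]

/-- The coefficient vector of `T` times a quadratic polynomial. -/
def shift (a : Fin 3 → ℤ) : Fin 4 → ℤ := ![0, a 0, a 1, a 2]

/-- The dot product of integer vectors of length four. -/
def dot4 (x p : Fin 4 → ℤ) : ℤ := x 0 * p 0 + x 1 * p 1 + x 2 * p 2 + x 3 * p 3

/-- A vector orthogonal to `incl a`, `shift a`, `incl b`. -/
def normalA (a b : Fin 3 → ℤ) : Fin 4 → ℤ :=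
  ![a 2 * cross a b 0, a 2 * cross a b 1, a 2 * cross a b 2,
    -(a 0 * cross a b 1 + a 1 * cross a b 2)]

/-- A vector orthogonal to `incl a`, `shift a`, `shift b`. -/
def normalB (a b : Fin 3 → ℤ) : Fin 4 → ℤ :=
  ![-(a 1 * cross a b 0 + a 2 * cross a b 1), a 0 * cross a b 0, a 0 * cross a b 1,
    a 0 * cross a b 2]

theorem cubicEval_incl (ζ : ℝ) (a : Fin 3 → ℤ) : cubicEval ζ (incl a) = quadEval ζ a := by
  simp [cubicEval, incl, quadEval]

theorem cubicEval_shift (ζ : ℝ) (a : Fin 3 → ℤ) : cubicEval ζ (shift a) = ζ * quadEval ζ a := by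
  simp [cubicEval, shift, quadEval]; ring

theorem dot4_normalA_shift (a b : Fin 3 → ℤ) :
    dot4 (normalA a b) (shift b) = disc (cross a b) := by
  simp [dot4, normalA, shift, disc]; ring

theorem dot4_normalB_shift (a b : Fin 3 → ℤ) : dot4 (normalB a b) (shift b) = 0 := by
  simp [dot4, normalB, shift]; ring

theorem dot4_normalA_incl (a b : Fin 3 → ℤ) : dot4 (normalA a b) (incl b) = 0 := by
  simp [dot4, normalA, incl]; ring

theorem dot4_normalB_incl (a b : Fin 3 → ℤ) :
    dot4 (normalB a b) (incl b) = -disc (cross a b) := by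
  simp [dot4, normalB, incl, disc]; ring

/-- Decomposition of a cubic polynomial along two coprime quadratic polynomials. -/
theorem disc_mul_eq (a b : Fin 3 → ℤ) (p : Fin 4 → ℤ) (i : Fin 4) :
    disc (cross a b) * p i = -dot4 (normalB b a) p * incl a i + dot4 (normalA b a) p * shift a i
      - dot4 (normalB a b) p * incl b i + dot4 (normalA a b) p * shift b i := by
  fin_cases i <;> simp [dot4, normalA, normalB, incl, shift, disc] <;> ring

theorem disc_mul_cubicEval (ζ : ℝ) (a b : Fin 3 → ℤ) (p : Fin 4 → ℤ)
    (hA : dot4 (normalA a b) p = 0) (hB : dot4 (normalB a b) p = 0) :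
    (disc (cross a b) : ℝ) * cubicEval ζ p =
      ((dot4 (normalA b a) p : ℝ) * ζ - dot4 (normalB b a) p) * quadEval ζ a := by
  have key : ∀ i, (disc (cross a b) : ℝ) * p i = -dot4 (normalB b a) p * incl a i
      + dot4 (normalA b a) p * shift a i := fun i => by
    have := disc_mul_eq a b p i
    rw [hA, hB] at this
    exact_mod_cast (by linear_combination this : disc (cross a b) * p i =
      -dot4 (normalB b a) p * incl a i + dot4 (normalA b a) p * shift a i)
  have h1 := cubicEval_incl ζ a
  have h2 := cubicEval_shift ζ a
  unfold cubicEval at *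
  linear_combination key 0 + ζ * key 1 + ζ ^ 2 * key 2 + ζ ^ 3 * key 3
    - (dot4 (normalB b a) p : ℝ) * h1 + (dot4 (normalA b a) p : ℝ) * h2

theorem disc_mul_dot4 (a b : Fin 3 → ℤ) (x p : Fin 4 → ℤ)
    (h : dot4 x (incl b) = 0) (h' : dot4 x (shift b) = 0) :
    disc (cross a b) * dot4 x p = -dot4 (normalB b a) p * dot4 x (incl a)
      + dot4 (normalA b a) p * dot4 x (shift a) := by
  have key := disc_mul_eq a b p
  unfold dot4 at h h' ⊢
  unfold dot4 at key
  linear_combination x 0 * key 0 + x 1 * key 1 + x 2 * key 2 + x 3 * key 3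
    - (normalB a b 0 * p 0 + normalB a b 1 * p 1 + normalB a b 2 * p 2 + normalB a b 3 * p 3) * h
    + (normalA a b 0 * p 0 + normalA a b 1 * p 1 + normalA a b 2 * p 2 + normalA a b 3 * p 3) * h'

/-- The vector `x` has first coordinate at most `m` and is at distance at most `l` from the
line through `(1, ζ, ζ ^ 2, ζ ^ 3)`. -/
def CubicApprox (ζ : ℝ) (x : Fin 4 → ℤ) (m l : ℝ) : Prop :=
  |(x 0 : ℝ)| ≤ m ∧ ∀ i, |(x i : ℝ) - ζ ^ (i : ℕ) * x 0| ≤ l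

theorem CubicApprox.abs_dot4_le {ζ m l h : ℝ} {x p : Fin 4 → ℤ} (hx : CubicApprox ζ x m l)
    (hp : ∀ i, |(p i : ℝ)| ≤ h) : |(dot4 x p : ℝ)| ≤ m * |cubicEval ζ p| + 3 * (l * h) := by
  have hl : 0 ≤ l := (abs_nonneg _).trans (hx.2 0)
  have h1 := hx.2 1
  have h2 := hx.2 2
  have h3 := hx.2 3
  simp only [Fin.val_one, pow_one, Fin.val_two, show ((3 : Fin 4) : ℕ) = 3 from rfl] at h1 h2 h3
  have : (dot4 x p : ℝ) = x 0 * cubicEval ζ p + (x 1 - ζ * x 0) * p 1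
      + (x 2 - ζ ^ 2 * x 0) * p 2 + (x 3 - ζ ^ 3 * x 0) * p 3 := by
    simp [dot4, cubicEval]; ring
  rw [this]
  refine (abs_add_le _ _).trans ((add_le_add_left (abs_add_three _ _ _) _).trans ?_)
  simp only [abs_mul]
  have e0 := mul_le_mul_of_nonneg_right hx.1 (abs_nonneg (cubicEval ζ p))
  have e1 := mul_le_mul h1 (hp 1) (abs_nonneg _) hl
  have e2 := mul_le_mul h2 (hp 2) (abs_nonneg _) hl
  have e3 := mul_le_mul h3 (hp 3) (abs_nonneg _) hl
  linarith

theorem abs_add_mul_le {u v w x y B C : ℝ} (hu : |u| ≤ B) (hx : |x| ≤ C) (hv : |v| ≤ B)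
    (hy : |y| ≤ C) (hw : |w| ≤ 2 * (B * C)) {c d e : ℝ} {z : ℝ}
    (h : z = c * (u * x) + d * (v * y) + e * w) :
    |z| ≤ (|c| + |d| + 2 * |e|) * (B * C) := by
  have hB : 0 ≤ B := (abs_nonneg _).trans hu
  rw [h]
  refine (abs_add_three _ _ _).trans ?_
  rw [abs_mul c, abs_mul d, abs_mul e, abs_mul u, abs_mul v]
  have e1 := mul_le_mul_of_nonneg_left (mul_le_mul hu hx (abs_nonneg _) hB) (abs_nonneg c)
  have e2 := mul_le_mul_of_nonneg_left (mul_le_mul hv hy (abs_nonneg _) hB) (abs_nonneg d)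
  have e3 := mul_le_mul_of_nonneg_left hw (abs_nonneg e)
  linarith

section Normal

variable {ζ g h : ℝ} {a b : Fin 3 → ℤ}

theorem abs_cross_mul_quadEval_le (ha : ∀ i, |(a i : ℝ)| ≤ g) (hb : ∀ i, |(b i : ℝ)| ≤ h) :
    |(cross a b 0 : ℝ) * quadEval ζ a| ≤ 2 * (g * (g * |quadEval ζ b| + h * |quadEval ζ a|)) := by
  rw [abs_mul]
  have hg : 0 ≤ g := (abs_nonneg _).trans (ha 0)
  have h1 := mul_le_mul_of_nonneg_right (abs_cross_le ha hb 0) (abs_nonneg (quadEval ζ a))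
  have h2 : 0 ≤ g * (g * |quadEval ζ b|) := by positivity
  linarith

theorem cubicApprox_normalA (ha : ∀ i, |(a i : ℝ)| ≤ g) (hb : ∀ i, |(b i : ℝ)| ≤ h) :
    CubicApprox ζ (normalA a b) (4 * (g * (g * h)))
      (3 * (1 + |ζ|) ^ 3 * (g * (g * |quadEval ζ b| + h * |quadEval ζ a|))) := by
  have hg : 0 ≤ g := (abs_nonneg _).trans (ha 0)
  have hh : 0 ≤ h := (abs_nonneg _).trans (hb 0)
  have hz := abs_nonneg ζ
  have h1 := abs_cross_one_sub_le (ζ := ζ) ha hb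
  have h2 := abs_cross_two_sub_sq_le (ζ := ζ) ha hb
  have h3 := abs_cross_mul_quadEval_le (ζ := ζ) ha hb
  have hc := abs_cross_le ha hb
  set l := g * |quadEval ζ b| + h * |quadEval ζ a| with hl
  have hgl : 0 ≤ g * l := by positivity
  constructor
  · simp only [normalA, Matrix.cons_val_zero, Int.cast_mul, abs_mul]
    have := mul_le_mul (ha 2) (hc 0) (abs_nonneg _) hg
    have : 0 ≤ g * (g * h) := by positivity
    linarith
  · have hle : ∀ {k : ℝ} {z : ℝ}, |z| ≤ k * (g * l) → k ≤ 3 * (1 + |ζ|) ^ 3 →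
        |z| ≤ 3 * (1 + |ζ|) ^ 3 * (g * l) := fun h hk =>
      h.trans (mul_le_mul_of_nonneg_right hk hgl)
    have hk : 0 ≤ |ζ| ^ 3 := by positivity
    intro i
    fin_cases i
    · refine hle (abs_add_mul_le (ha 2) h1 (ha 2) h1 h3 (c := 0) (d := 0) (e := 0) ?_) ?_
      · simp [normalA]
      · simp; positivity
    · refine hle (abs_add_mul_le (ha 2) h1 (ha 2) h1 h3 (c := 1) (d := 0) (e := 0) ?_) ?_
      · simp [normalA]; ring
      · simp; nlinarith
    · refine hle (abs_add_mul_le (ha 2) h2 (ha 2) h1 h3 (c := 1) (d := 0) (e := 0) ?_) ?_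
      · simp [normalA]; ring
      · simp; nlinarith
    · refine hle (abs_add_mul_le (ha 0) h1 (ha 1) h2 h3 (c := -1) (d := -1) (e := -ζ) ?_) ?_
      · simp [normalA, quadEval]; ring
      · simp; nlinarith

theorem cubicApprox_normalB (ha : ∀ i, |(a i : ℝ)| ≤ g) (hb : ∀ i, |(b i : ℝ)| ≤ h) :
    CubicApprox ζ (normalB a b) (4 * (g * (g * h)))
      (3 * (1 + |ζ|) ^ 3 * (g * (g * |quadEval ζ b| + h * |quadEval ζ a|))) := by
  have hg : 0 ≤ g := (abs_nonneg _).trans (ha 0)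
  have hh : 0 ≤ h := (abs_nonneg _).trans (hb 0)
  have hz := abs_nonneg ζ
  have h1 := abs_cross_one_sub_le (ζ := ζ) ha hb
  have h2 := abs_cross_two_sub_sq_le (ζ := ζ) ha hb
  have h3 := abs_cross_mul_quadEval_le (ζ := ζ) ha hb
  have hc := abs_cross_le ha hb
  set l := g * |quadEval ζ b| + h * |quadEval ζ a| with hl
  have hgl : 0 ≤ g * l := by positivity
  constructor
  · simp only [normalB, Matrix.cons_val_zero, Int.cast_mul, Int.cast_add, Int.cast_neg, abs_neg]
    refine (abs_add_le _ _).trans ?_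
    rw [abs_mul, abs_mul]
    have e1 := mul_le_mul (ha 1) (hc 0) (abs_nonneg _) hg
    have e2 := mul_le_mul (ha 2) (hc 1) (abs_nonneg _) hg
    linarith
  · have hle : ∀ {k : ℝ} {z : ℝ}, |z| ≤ k * (g * l) → k ≤ 3 * (1 + |ζ|) ^ 3 →
        |z| ≤ 3 * (1 + |ζ|) ^ 3 * (g * l) := fun h hk =>
      h.trans (mul_le_mul_of_nonneg_right hk hgl)
    have hk : 0 ≤ |ζ| ^ 3 := by positivity
    intro i
    fin_cases i
    · refine hle (abs_add_mul_le (ha 2) h1 (ha 2) h1 h3 (c := 0) (d := 0) (e := 0) ?_) ?_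
      · simp [normalB]
      · simp; positivity
    · refine hle (abs_add_mul_le (ha 2) h1 (ha 2) h1 h3 (c := ζ) (d := 0) (e := 1) ?_) ?_
      · simp [normalB, quadEval]; ring
      · simp; nlinarith
    · refine hle (abs_add_mul_le (ha 0) h1 (ha 2) h1 h3 (c := 1) (d := ζ ^ 2) (e := ζ) ?_) ?_
      · simp [normalB, quadEval]; ring
      · simp only [abs_one, abs_pow]; nlinarith
    · refine hle (abs_add_mul_le (ha 0) h2 (ha 2) h1 h3 (c := 1) (d := ζ ^ 3) (e := ζ ^ 2) ?_) ?_
      · simp [normalB, quadEval]; ring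
      · simp only [abs_one, abs_pow]; nlinarith

end Normal

namespace GoodPair

variable {ζ ε U V : ℝ} {a b : Fin 3 → ℤ}

theorem exp_mul_add_le (h : GoodPair ζ ε a b U V) (hε : ε ≤ 1) :
    exp U * |quadEval ζ b| + exp V * |quadEval ζ a| ≤ 2 * exp (V - (2 * φ + 1 - ε) * U) := by
  have hφ := goldenRatio_gt
  have hlt := h.lt
  have e1 : exp U * |quadEval ζ b| ≤ exp (V - (2 * φ + 1 - ε) * U) := by
    refine (mul_le_mul_of_nonneg_left h.eval_right_le (exp_pos _).le).trans ?_
    rw [← exp_add]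
    refine exp_le_exp.mpr ?_
    nlinarith
  have e2 : exp V * |quadEval ζ a| ≤ exp (V - (2 * φ + 1 - ε) * U) := by
    refine (mul_le_mul_of_nonneg_left h.eval_left_le (exp_pos _).le).trans ?_
    rw [← exp_add]
    refine exp_le_exp.mpr ?_
    linarith
  linarith

theorem _root_.ExtremalNumber.CubicApprox.mono {ζ m l m' l' : ℝ} {x : Fin 4 → ℤ}
    (h : CubicApprox ζ x m l) (hm : m ≤ m') (hl : l ≤ l') : CubicApprox ζ x m' l' :=
  ⟨h.1.trans hm, fun i => (h.2 i).trans hl⟩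

theorem size_le (h : GoodPair ζ ε a b U V) (hε : ε ≤ 1) (W : ℝ) :
    3 * (1 + |ζ|) ^ 3 * (exp W * (exp U * |quadEval ζ b| + exp V * |quadEval ζ a|)) ≤
      6 * (1 + |ζ|) ^ 3 * exp (W + V - (2 * φ + 1 - ε) * U) := by
  have h1 := mul_le_mul_of_nonneg_left (h.exp_mul_add_le hε) (exp_pos W).le
  have h2 : exp (W + V - (2 * φ + 1 - ε) * U) = exp W * exp (V - (2 * φ + 1 - ε) * U) := by
    rw [← exp_add]; ring_nf
  rw [h2]
  have h3 : 0 ≤ 3 * (1 + |ζ|) ^ 3 := by positivity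
  nlinarith [mul_le_mul_of_nonneg_left h1 h3]

theorem normalA_left (h : GoodPair ζ ε a b U V) (hε : ε ≤ 1) :
    CubicApprox ζ (normalA a b) (4 * exp (2 * U + V))
      (6 * (1 + |ζ|) ^ 3 * exp (U + V - (2 * φ + 1 - ε) * U)) :=
  (cubicApprox_normalA h.abs_left_le h.abs_right_le).mono
    (by rw [← exp_add, ← exp_add]; ring_nf; rfl) (h.size_le hε U)

theorem normalB_left (h : GoodPair ζ ε a b U V) (hε : ε ≤ 1) :
    CubicApprox ζ (normalB a b) (4 * exp (2 * U + V))
      (6 * (1 + |ζ|) ^ 3 * exp (U + V - (2 * φ + 1 - ε) * U)) :=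
  (cubicApprox_normalB h.abs_left_le h.abs_right_le).mono
    (by rw [← exp_add, ← exp_add]; ring_nf; rfl) (h.size_le hε U)

theorem normalA_right (h : GoodPair ζ ε a b U V) (hε : ε ≤ 1) :
    CubicApprox ζ (normalA b a) (4 * exp (2 * V + U))
      (6 * (1 + |ζ|) ^ 3 * exp (V + V - (2 * φ + 1 - ε) * U)) :=
  (cubicApprox_normalA h.abs_right_le h.abs_left_le).mono
    (by rw [← exp_add, ← exp_add]; ring_nf; rfl)
    (by rw [add_comm (exp V * _)]; exact h.size_le hε V)

theorem abs_disc_le_exp (h : GoodPair ζ ε a b U V) (hε : ε ≤ 1) :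
    |(disc (cross a b) : ℝ)| ≤ 4 * (2 + |ζ|) * exp (U + V + V - (2 * φ + 1 - ε) * U) := by
  have hl := h.exp_mul_add_le hε
  have h1 := abs_disc_le (abs_cross_le h.abs_left_le h.abs_right_le)
    ((abs_cross_one_sub_le (ζ := ζ) h.abs_left_le h.abs_right_le).trans hl)
    ((abs_cross_two_sub_sq_le (ζ := ζ) h.abs_left_le h.abs_right_le).trans hl)
  refine h1.trans (le_of_eq ?_)
  rw [show U + V + V - (2 * φ + 1 - ε) * U = U + V + (V - (2 * φ + 1 - ε) * U) by ring,
    exp_add, exp_add]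
  ring

/-- Lower bound for the first polynomial of the pair. -/
theorem le_eval_left (h : GoodPair ζ ε a b U V) (hε : ε ≤ 1 / 10)
    (hU : 4 * (2 + |ζ|) + 2 ≤ U) :
    exp (-(4 * (2 + |ζ|)) - U - 2 * V) ≤ |quadEval ζ a| := by
  have hφ := goldenRatio_gt
  have hlt := h.lt
  have h1 := abs_disc_le (abs_cross_le h.abs_left_le h.abs_right_le)
    (abs_cross_one_sub_le (ζ := ζ) h.abs_left_le h.abs_right_le)
    (abs_cross_two_sub_sq_le (ζ := ζ) h.abs_left_le h.abs_right_le)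
  have h2 : (1 : ℝ) ≤ |(disc (cross a b) : ℝ)| := by exact_mod_cast Int.one_le_abs h.disc_ne_zero
  have h3 : (2 + |ζ|) * (2 * (exp U * exp V) * (exp U * |quadEval ζ b|)) ≤ 1 / 2 := by
    have e1 := mul_le_mul_of_nonneg_left h.eval_right_le (exp_pos U).le
    have e2 : 2 * (2 + |ζ|) * (exp U * exp V * (exp U * exp (-(2 * φ + 1 - ε) * V))) ≤ 1 / 2 := by
      rw [← exp_add, ← exp_add, ← exp_add]
      refine le_trans (b := 4 * (2 + |ζ|) * exp (-1 * U)) ?_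
        ((mul_exp_neg_lt (by linarith)).le.trans (by norm_num))
      have e3 : exp (U + V + (U + -(2 * φ + 1 - ε) * V)) ≤ exp (-1 * U) :=
        exp_le_exp.mpr (by nlinarith [h.nonneg])
      have := abs_nonneg ζ
      nlinarith [exp_pos (-1 * U)]
    have e3 := mul_le_mul_of_nonneg_left e1 (show 0 ≤ 2 * (2 + |ζ|) * (exp U * exp V) by positivity)
    linarith
  have h4 : 1 ≤ 4 * (2 + |ζ|) * exp (U + 2 * V) * |quadEval ζ a| := by
    rw [two_mul V, exp_add, exp_add]
    linarith
  have h5 : 4 * (2 + |ζ|) * exp (U + 2 * V) ≤ exp (4 * (2 + |ζ|) + (U + 2 * V)) :=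
    mul_exp_le_exp le_rfl
  rw [show -(4 * (2 + |ζ|)) - U - 2 * V = -(4 * (2 + |ζ|) + (U + 2 * V)) by ring, exp_neg,
    inv_le_iff_one_le_mul₀ (exp_pos _)]
  refine h4.trans ?_
  rw [mul_comm (|quadEval ζ a|)]
  exact mul_le_mul_of_nonneg_right h5 (abs_nonneg _)

end GoodPair

theorem rpow_eq_exp {X : ℝ} (hX : 0 < X) (η : ℝ) : X ^ (-η) = exp (-η * log X) := by
  rw [rpow_def_of_pos hX, mul_comm]

theorem wSetJ_of_le {n j : ℕ} {ζ η η' : ℝ} (h : η ∈ wSetJ n j ζ) (hle : η' ≤ η) :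
    η' ∈ wSetJ n j ζ := by
  intro X₀
  obtain ⟨X, hX, P, hP, h⟩ := h (max X₀ 1)
  refine ⟨X, (le_max_left _ _).trans hX, P, hP, fun i => ⟨(h i).1, (h i).2.1, (h i).2.2.1, ?_⟩⟩
  exact (h i).2.2.2.trans
    (rpow_le_rpow_of_exponent_le ((le_max_right _ _).trans hX) (by linarith))

theorem lamSetJ_of_le {n j : ℕ} {ζ η η' : ℝ} (h : η ∈ lamSetJ n j ζ) (hle : η' ≤ η) :
    η' ∈ lamSetJ n j ζ := by
  intro X₀
  obtain ⟨X, hX, P, hP, h⟩ := h (max X₀ 1)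
  refine ⟨X, (le_max_left _ _).trans hX, P, hP, fun i => ⟨(h i).1, fun t => ?_⟩⟩
  exact ((h i).2 t).trans
    (rpow_le_rpow_of_exponent_le ((le_max_right _ _).trans hX) (by linarith))

theorem wSetJ_subset {n j k : ℕ} (hjk : j ≤ k) (ζ : ℝ) : wSetJ n k ζ ⊆ wSetJ n j ζ := by
  intro η h X₀
  obtain ⟨X, hX, P, hP, h⟩ := h X₀
  exact ⟨X, hX, P ∘ Fin.castLE hjk, hP.comp _ (Fin.castLE_injective hjk), fun i => h _⟩

theorem lamSetJ_subset {n j k : ℕ} (hjk : j ≤ k) (ζ : ℝ) : lamSetJ n k ζ ⊆ lamSetJ n j ζ := by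
  intro η h X₀
  obtain ⟨X, hX, P, hP, h⟩ := h X₀
  exact ⟨X, hX, P ∘ Fin.castLE hjk, hP.comp _ (Fin.castLE_injective hjk), fun i => h _⟩

theorem exists_goodPair_ge {ζ : ℝ} (hζ : Transcendental ℚ ζ) (hU : UniformApprox ζ) {ε : ℝ}
    (h0 : 0 < ε) (h1 : ε ≤ 1) (B : ℝ) :
    ∃ (a b : Fin 3 → ℤ) (U V : ℝ), GoodPair ζ ε a b U V ∧ B ≤ U := by
  obtain ⟨Y₀, h⟩ := exists_goodPair hζ hU h0 h1
  obtain ⟨a, b, U, V, hg, -, hV⟩ := h (max Y₀ (3 * B)) (le_max_left _ _)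
  refine ⟨a, b, U, V, hg, ?_⟩
  have := goldenRatio_lt
  have := (le_max_right Y₀ (3 * B)).trans hV.le
  nlinarith [hg.le_mul, hg.nonneg]

theorem GoodPair.left_ne_zero {ζ ε U V : ℝ} {a b : Fin 3 → ℤ} (h : GoodPair ζ ε a b U V) :
    a ≠ 0 := by
  rintro rfl
  exact h.disc_ne_zero (by simp [disc])

/-- The polynomial of degree at most three with coefficient vector `p`. -/
noncomputable def toPoly (p : Fin 4 → ℤ) : Polynomial ℤ :=
  ∑ i : Fin 4, Polynomial.monomial (i : ℕ) (p i)

theorem natDegree_toPoly_le (p : Fin 4 → ℤ) : (toPoly p).natDegree ≤ 3 :=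
  Polynomial.natDegree_sum_le_of_forall_le _ _ fun i _ =>
    (Polynomial.natDegree_monomial_le _).trans (by omega)

theorem pev_toPoly (ζ : ℝ) (p : Fin 4 → ℤ) : pev ζ (toPoly p) = cubicEval ζ p := by
  simp [pev, toPoly, cubicEval, Fin.sum_univ_four, Polynomial.aeval_monomial]

theorem abs_coeff_toPoly_le {p : Fin 4 → ℤ} {h : ℝ} (h0 : 0 ≤ h) (hp : ∀ i, |(p i : ℝ)| ≤ h)
    (i : ℕ) : |((toPoly p).coeff i : ℝ)| ≤ h := by
  by_cases hi : i < 4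
  · have : (toPoly p).coeff i = p ⟨i, hi⟩ := by
      rw [toPoly, Polynomial.finsetSum_coeff]
      simp only [Polynomial.coeff_monomial]
      interval_cases i <;> simp [Fin.sum_univ_four]
    rw [this]
    exact hp _
  · rw [Polynomial.coeff_eq_zero_of_natDegree_lt
      (lt_of_le_of_lt (natDegree_toPoly_le p) (by omega))]
    simpa using h0

theorem abs_incl_le {a : Fin 3 → ℤ} {h : ℝ} (ha : ∀ i, |(a i : ℝ)| ≤ h) (i : Fin 4) :
    |(incl a i : ℝ)| ≤ h := by
  have h0 : 0 ≤ h := (abs_nonneg _).trans (ha 0)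
  fin_cases i <;> simp [incl, ha, h0]

theorem abs_shift_le {a : Fin 3 → ℤ} {h : ℝ} (ha : ∀ i, |(a i : ℝ)| ≤ h) (i : Fin 4) :
    |(shift a i : ℝ)| ≤ h := by
  have h0 : 0 ≤ h := (abs_nonneg _).trans (ha 0)
  fin_cases i <;> simp [shift, ha, h0]

theorem ne_zero_of_transcendental {ζ : ℝ} (hζ : Transcendental ℚ ζ) : ζ ≠ 0 := by
  have := sub_mul_ne_zero hζ (s := 1) (t := 0) one_ne_zero
  simpa using this

theorem mem_wSetJ_of_lt {ζ : ℝ} (hζ : Transcendental ℚ ζ) (hU : UniformApprox ζ) {η : ℝ}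
    (hη : η < 2 * φ + 1) : η ∈ wSetJ 3 2 ζ := by
  intro X₀
  set θ := 2 * φ + 1 - η with hθ
  have hθ0 : 0 < θ := by linarith
  obtain ⟨a, b, U, V, h, hB⟩ := exists_goodPair_ge hζ hU (ε := min 1 (θ / 2)) (by positivity)
    (min_le_left _ _) (max X₀ (2 * |ζ| / θ))
  have hU1 : X₀ ≤ U := (le_max_left _ _).trans hB
  have hU2 : 2 * |ζ| ≤ θ * U := by
    have := (le_max_right _ _).trans hB
    rw [div_le_iff₀ hθ0] at this
    linarith
  have ha := quadEval_ne_zero hζ h.left_ne_zero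
  have hζ0 := ne_zero_of_transcendental hζ
  have hmin := min_le_right 1 (θ / 2)
  have hea : |quadEval ζ a| ≤ exp (-(2 * φ + 1 - θ / 2) * U) := by
    refine h.eval_left_le.trans (exp_le_exp.mpr ?_)
    nlinarith [h.nonneg]
  have hX : exp U ^ (-η) = exp (-η * U) := by rw [rpow_eq_exp (exp_pos U), log_exp]
  refine ⟨exp U, le_exp_of_le hU1, ![toPoly (incl a), toPoly (shift a)], ?_, ?_⟩
  · rw [LinearIndependent.pair_iff]
    intro s t hst
    have h1 := congrArg (pev ζ) hst
    have h2 : (s + t * ζ) * quadEval ζ a = 0 := by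
      have e1 := pev_toPoly ζ (incl a)
      have e2 := pev_toPoly ζ (shift a)
      rw [cubicEval_incl] at e1
      rw [cubicEval_shift] at e2
      simp only [pev, map_add, map_zero, zsmul_eq_mul, map_mul, map_intCast] at h1 e1 e2
      rw [e1, e2] at h1
      linear_combination h1
    have h3 : (s : ℝ) + t * ζ = 0 := (mul_eq_zero.mp h2).resolve_right ha
    have ht : t = 0 := by
      by_contra ht
      apply sub_mul_ne_zero hζ (s := t) (t := -s) ht
      push_cast
      linarith
    subst ht
    simpa using h3
  · intro i
    fin_cases i
    · refine ⟨natDegree_toPoly_le _,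
        polyH_le (exp_pos _).le (abs_coeff_toPoly_le (exp_pos _).le (abs_incl_le h.abs_left_le)),
        ?_, ?_⟩
      · simpa [pev_toPoly, cubicEval_incl] using ha
      · simp only [Fin.zero_eta, Matrix.cons_val_zero, pev_toPoly, cubicEval_incl, hX]
        refine hea.trans (exp_le_exp.mpr ?_)
        nlinarith [h.nonneg]
    · refine ⟨natDegree_toPoly_le _,
        polyH_le (exp_pos _).le (abs_coeff_toPoly_le (exp_pos _).le (abs_shift_le h.abs_left_le)),
        ?_, ?_⟩
      · simp only [Fin.mk_one, Matrix.cons_val_one, Matrix.cons_val_zero, pev_toPoly,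
          cubicEval_shift]
        exact abs_pos.mpr (mul_ne_zero hζ0 ha)
      · simp only [Fin.mk_one, Matrix.cons_val_one, Matrix.cons_val_zero, pev_toPoly,
          cubicEval_shift, hX, abs_mul]
        refine (mul_le_mul_of_nonneg_left hea (abs_nonneg ζ)).trans (mul_exp_le_exp ?_)
        nlinarith [h.nonneg]

theorem mul_exp_lt_quarter {C x : ℝ} (h : C + 2 + x ≤ 0) : C * exp x < 1 / 4 := by
  have := mul_exp_neg_lt (C := C) (k := 1) (L := -x) (by linarith)
  simpa using this

theorem one_div_sqrt_five_mul : 1 / √5 * (φ + 2) = φ := by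
  have h : √5 * √5 = 5 := Real.mul_self_sqrt (by norm_num)
  have h0 : √5 ≠ 0 := by positivity
  unfold Real.goldenRatio
  field_simp
  nlinarith

theorem mem_lamSetJ_of_lt {ζ : ℝ} (hζ : Transcendental ℚ ζ) (hU : UniformApprox ζ) {η : ℝ}
    (hη : η < 1 / √5) : η ∈ lamSetJ 3 2 ζ := by
  have hφ := goldenRatio_gt
  have hφ' := goldenRatio_lt
  have hr := one_div_sqrt_five_mul
  set r := 1 / √5 with hrdef
  have hr0 : 0 < r := by positivity
  have hr1 : r < 1 := by nlinarith
  refine lamSetJ_of_le ?_ (le_max_left η 0)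
  have hη0 : 0 ≤ max η 0 := le_max_right _ _
  have hη1 : max η 0 < r := max_lt hη hr0
  generalize max η 0 = η at hη0 hη1
  intro X₀
  set θ := r - η with hθ
  have hθ0 : 0 < θ := by linarith
  set C := 6 * (1 + |ζ|) ^ 3 with hC
  obtain ⟨a, b, U, V, h, hB⟩ := exists_goodPair_ge hζ hU (ε := θ / 2) (by positivity)
    (by linarith) (max X₀ ((C + 2) / θ))
  have hU1 : X₀ ≤ U := (le_max_left _ _).trans hB
  have hU2 : C + 2 ≤ θ * U := by
    have := (le_max_right _ _).trans hB
    rw [div_le_iff₀ hθ0] at this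
    linarith
  have hlt := h.lt
  have hle := h.le_mul
  have hnn := h.nonneg
  have hkey : C + (U + V - (2 * φ + 1 - θ / 2) * U) ≤ -η * (2 + 2 * U + V) := by
    have h1 : η * V ≤ η * ((φ + θ / 2) * U) := mul_le_mul_of_nonneg_left hle hη0
    have hηr : η = r - θ := by linarith
    have h2 : η * ((φ + 2) * U) = φ * U - θ * ((φ + 2) * U) := by
      rw [hηr]; linear_combination U * hr
    have h3 : 0 ≤ θ * U := by positivity
    have h4 : η * (θ * U) ≤ 1 * (θ * U) := mul_le_mul_of_nonneg_right (by linarith) h3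
    have h5 : 1.618 * (θ * U) ≤ φ * (θ * U) := mul_le_mul_of_nonneg_right hφ.le h3
    nlinarith
  have hX : exp (2 + 2 * U + V) ^ (-η) = exp (-η * (2 + 2 * U + V)) := by
    rw [rpow_eq_exp (exp_pos _), log_exp]
  have hsize : 4 * exp (2 * U + V) ≤ exp (2 + 2 * U + V) := by
    rw [add_assoc, exp_add 2]
    exact mul_le_mul_of_nonneg_right four_le_exp_two (exp_pos _).le
  refine ⟨exp (2 + 2 * U + V), le_exp_of_le (by linarith), ![normalA a b, normalB a b], ?_, ?_⟩
  · rw [LinearIndependent.pair_iff]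
    intro s t hst
    have h1 : s * disc (cross a b) = 0 := by
      rw [← dot4_normalA_shift]
      have e := fun i => congrFun hst i
      have e2 := dot4_normalB_shift a b
      simp only [Pi.add_apply, Pi.smul_apply, smul_eq_mul, Pi.zero_apply] at e
      unfold dot4 at *
      linear_combination shift b 0 * e 0 + shift b 1 * e 1 + shift b 2 * e 2 + shift b 3 * e 3
        - t * e2
    have h2 : t * -disc (cross a b) = 0 := by
      rw [← dot4_normalB_incl]
      have e := fun i => congrFun hst i
      have e2 := dot4_normalA_incl a b
      simp only [Pi.add_apply, Pi.smul_apply, smul_eq_mul, Pi.zero_apply] at e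
      unfold dot4 at *
      linear_combination incl b 0 * e 0 + incl b 1 * e 1 + incl b 2 * e 2 + incl b 3 * e 3
        - s * e2
    exact ⟨(mul_eq_zero.mp h1).resolve_right h.disc_ne_zero,
      (mul_eq_zero.mp h2).resolve_right (neg_ne_zero.mpr h.disc_ne_zero)⟩
  · have main : ∀ x : Fin 4 → ℤ, CubicApprox ζ x (4 * exp (2 * U + V))
        (C * exp (U + V - (2 * φ + 1 - θ / 2) * U)) →
        ((|x 0| : ℤ) : ℝ) ≤ exp (2 + 2 * U + V) ∧ ∀ t : Fin 3,
          |ζ ^ ((t : ℕ) + 1) * ((x 0 : ℤ) : ℝ) - ((x t.succ : ℤ) : ℝ)|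
            ≤ exp (2 + 2 * U + V) ^ (-η) := by
      intro x hx
      refine ⟨?_, fun t => ?_⟩
      · push_cast
        exact hx.1.trans hsize
      · rw [hX, abs_sub_comm, ← Fin.val_succ]
        exact (hx.2 t.succ).trans (mul_exp_le_exp hkey)
    intro i
    fin_cases i
    · exact main _ (h.normalA_left (by linarith))
    · exact main _ (h.normalB_left (by linarith))

theorem polynomial_arith {p e K U V M η : ℝ} (hp : 1.618 < p) (hp' : p < 1.6181)
    (hpp : p * p = p + 1) (he : 0 < e) (he' : e ≤ 1 / 100) (hη : η = 2 * p + 1 + 100 * e)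
    (hK : 0 ≤ K) (hM : K ≤ e * M) (hUM : U ≤ (1 + 4 * e) * M) (hVM : (1 + 4 * e) * M ≤ V)
    (hV : V ≤ (p + e) * U) :
    M ≤ 2 * U ∧ K + 2 * U + V - η * M ≤ 0 ∧ K + M + U + V - (2 * p + 1 - e) * U ≤ 0 ∧
      K + 2 * V + U - η * M ≤ 0 ∧ M + 2 * V - (2 * p + 1 - e) * U ≤ M - (1 - 3 * e) * U ∧
      K + (2 * p + 1 + 5 * e) * U - η * M < 0 ∨ M ≤ 0 := by
  rcases le_or_gt M 0 with h | hM0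
  · exact Or.inr h
  left
  have heM : 0 < e * M := mul_pos he hM0
  have heeM : e * (e * M) ≤ 1 / 100 * (e * M) := mul_le_mul_of_nonneg_right he' heM.le
  have hpeM : p * (e * M) ≤ 1.6181 * (e * M) := mul_le_mul_of_nonneg_right hp'.le heM.le
  have hpeM' : 1.618 * (e * M) ≤ p * (e * M) := mul_le_mul_of_nonneg_right hp.le heM.le
  have hη' : η * M = (2 * p + 1) * M + 100 * (e * M) := by rw [hη]; ring
  have hU0 : 0 < U := by
    by_contra hneg
    nlinarith
  have hMU : M ≤ 2 * U := by nlinarith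
  have hpU : p * U ≤ p * M + 4 * (p * (e * M)) := by nlinarith
  have heU : e * U ≤ 2 * (e * M) := by nlinarith
  have heU0 : 0 < e * U := mul_pos he hU0
  refine ⟨hMU, by nlinarith, ?_, by nlinarith, by linarith, by nlinarith⟩
  have h1 : (p - 2 * e) * ((1 + 4 * e) * M) ≤ (p - 2 * e) * ((p + e) * U) :=
    mul_le_mul_of_nonneg_left (hVM.trans hV) (by linarith)
  have h2 : (p + e) * ((1 + e) * M) ≤ (p - 2 * e) * ((1 + 4 * e) * M) := by nlinarith
  have h3 : (p + e) * ((1 + e) * M) ≤ (p + e) * ((p - 2 * e) * U) := by linarith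
  have h4 : (1 + e) * M ≤ (p - 2 * e) * U := le_of_mul_le_mul_left h3 (by linarith)
  nlinarith

theorem polynomial_arith' {p e K U M η : ℝ} (hp : 1.618 < p) (hp' : p < 1.6181)
    (he : 0 < e) (he' : e ≤ 1 / 100) (hη : η = 2 * p + 1 + 100 * e)
    (hM0 : 0 < M) (hM : K ≤ e * M) (hUM : U ≤ (1 + 4 * e) * M) :
    K + (2 * p + 1 + 5 * e) * U + (1 + e) * (M - (1 - 3 * e) * U) - η * M < 0 := by
  have heM : 0 < e * M := mul_pos he hM0
  have heeM : e * (e * M) ≤ 1 / 100 * (e * M) := mul_le_mul_of_nonneg_right he' heM.le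
  have heeeM : e * (e * (e * M)) ≤ 1 / 100 * (e * (e * M)) :=
    mul_le_mul_of_nonneg_right he' (by positivity)
  have hpeM : p * (e * M) ≤ 1.6181 * (e * M) := mul_le_mul_of_nonneg_right hp'.le heM.le
  have h1 : 0 ≤ 2 * p + 1 + 5 * e - (1 + e) * (1 - 3 * e) := by nlinarith
  have h2 := mul_le_mul_of_nonneg_left hUM h1
  rw [hη]
  nlinarith

theorem exists_coeff_of_poly (ζ : ℝ) {P : Polynomial ℤ} (hP : P.natDegree ≤ 3) :
    ∃ p : Fin 4 → ℤ, (∀ i, |(p i : ℝ)| ≤ polyH P) ∧ cubicEval ζ p = pev ζ P := by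
  refine ⟨fun i => P.coeff i, fun i => abs_coeff_le_polyH P i, ?_⟩
  unfold pev cubicEval
  rw [Polynomial.aeval_eq_sum_range' (show P.natDegree < 4 by omega)]
  simp [Finset.sum_range_succ]

theorem eq_zero_of_abs_lt_one {n : ℤ} (h : |(n : ℝ)| < 1) : n = 0 :=
  Int.abs_lt_one_iff.mp (by exact_mod_cast h)

theorem le_of_mem_wSetJ {ζ : ℝ} (hζ : Transcendental ℚ ζ) (hU : UniformApprox ζ) {η : ℝ}
    (hmem : η ∈ wSetJ 3 1 ζ) : η ≤ 2 * φ + 1 := by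
  have hφ := goldenRatio_gt
  have hφ' := goldenRatio_lt
  have hφφ := goldenRatio_mul_self
  by_contra! hlt
  obtain ⟨e, he, he', hle⟩ : ∃ e : ℝ, 0 < e ∧ e ≤ 1 / 100 ∧ 2 * φ + 1 + 100 * e ≤ η :=
    ⟨min (1 / 100) ((η - (2 * φ + 1)) / 100), lt_min (by norm_num) (by linarith),
      min_le_left _ _, by linarith [min_le_right (1 / 100) ((η - (2 * φ + 1)) / 100)]⟩
  have hmem := wSetJ_of_le hmem hle
  obtain ⟨η', hη'⟩ : ∃ η', η' = 2 * φ + 1 + 100 * e := ⟨_, rfl⟩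
  rw [← hη'] at hmem
  obtain ⟨b₀, hb₀, hrat⟩ := exists_rational_bound hζ hU he (by linarith)
  obtain ⟨Y₀, hpair⟩ := exists_goodPair hζ hU he (by linarith)
  have hz := abs_nonneg ζ
  set C := 6 * (1 + |ζ|) ^ 3 with hC
  have hC0 : 6 ≤ C := by
    have : (1 : ℝ) ≤ (1 + |ζ|) ^ 3 := one_le_pow₀ (by linarith)
    linarith
  set D := 4 * (2 + |ζ|) with hD
  obtain ⟨K, hK⟩ : ∃ K, K = b₀ + 8 * C + 2 * D + 10 := ⟨_, rfl⟩
  have hK0 : 0 ≤ K := by linarith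
  obtain ⟨X, hX, P, -, hP⟩ := hmem (exp (max (K / e) (max 1 Y₀)))
  obtain ⟨hdeg, hH, hpos, hev⟩ := hP 0
  obtain ⟨p, hp, hpe⟩ := exists_coeff_of_poly ζ hdeg
  have hX0 : 0 < X := (exp_pos _).trans_le hX
  obtain ⟨M, hM⟩ : ∃ M, M = log X := ⟨_, rfl⟩
  have hXM : X = exp M := by rw [hM, exp_log hX0]
  have hM1 : max (K / e) (max 1 Y₀) ≤ M := by rw [hM, le_log_iff_exp_le hX0]; exact hX
  have hM2 : K ≤ e * M := by
    have := (le_max_left _ _).trans hM1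
    rw [div_le_iff₀ he] at this
    linarith
  have hM3 : 1 ≤ M := (le_max_left _ _).trans ((le_max_right _ _).trans hM1)
  have hM4 : Y₀ ≤ M := (le_max_right _ _).trans ((le_max_right _ _).trans hM1)
  rw [rpow_eq_exp hX0, ← hM, ← hpe] at hev
  rw [← hpe] at hpos
  have hp' : ∀ i, |(p i : ℝ)| ≤ exp M := fun i => (hp i).trans (hH.trans hXM.le)
  obtain ⟨a, b, U, V, h, hUY, hVY⟩ := hpair ((1 + 4 * e) * M) (by nlinarith)
  obtain ⟨i1, i2, i3, i4, i5, i6⟩ := (polynomial_arith hφ hφ' hφφ he he' hη' hK0 hM2 hUY hVY.le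
    h.le_mul).resolve_right (by linarith)
  have i7 := polynomial_arith' hφ hφ' he he' hη' (by linarith) hM2 hUY
  have hKM : K ≤ 1 / 100 * M := hM2.trans (mul_le_mul_of_nonneg_right he' (by linarith))
  have he1 : e ≤ 1 := by linarith
  have hleft : ∀ x, CubicApprox ζ x (4 * exp (2 * U + V))
      (C * exp (U + V - (2 * φ + 1 - e) * U)) → dot4 x p = 0 := by
    intro x hx
    apply eq_zero_of_abs_lt_one
    refine (hx.abs_dot4_le hp').trans_lt ?_
    have e1 := mul_le_mul_of_nonneg_left hev (show 0 ≤ 4 * exp (2 * U + V) by positivity)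
    rw [mul_assoc 4 _ (exp (-η' * M)), ← exp_add] at e1
    have e2 := mul_exp_lt_quarter (C := 4) (x := 2 * U + V + -η' * M) (by linarith)
    have e3 := mul_exp_lt_quarter (C := 3 * C) (x := U + V - (2 * φ + 1 - e) * U + M) (by linarith)
    rw [exp_add (U + V - _)] at e3
    linarith
  have hA := hleft _ (h.normalA_left he1)
  have hB := hleft _ (h.normalB_left he1)
  have hdec := disc_mul_cubicEval ζ a b p hA hB
  set s := dot4 (normalA b a) p with hs
  set t := dot4 (normalB b a) p with ht
  have hR : (disc (cross a b) : ℝ) ≠ 0 := by exact_mod_cast h.disc_ne_zero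
  have hst : (t : ℝ) - ζ * s ≠ 0 := by
    intro h0
    have : (s : ℝ) * ζ - t = 0 := by linarith
    rw [this, zero_mul] at hdec
    exact mul_ne_zero hR (abs_pos.mp hpos) hdec
  have hsmall : |(t : ℝ) - ζ * s| ≤ exp (2 * D + (2 * φ + 1 + 5 * e) * U - η' * M) := by
    have e0 := h.le_eval_left (by linarith) (by linarith)
    have e1 := congrArg abs hdec
    rw [abs_mul, abs_mul, abs_sub_comm, mul_comm (s : ℝ)] at e1
    have e2 := mul_le_mul (h.abs_disc_le_exp he1) hev (abs_nonneg _) (by positivity)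
    rw [e1, mul_assoc, ← exp_add] at e2
    have e3 := mul_le_mul_of_nonneg_left e0 (abs_nonneg ((t : ℝ) - ζ * s))
    have e4 := (e3.trans e2).trans (mul_exp_le_exp le_rfl)
    rw [← hD, ← le_div_iff₀ (exp_pos _), ← exp_sub] at e4
    refine e4.trans (exp_le_exp.mpr ?_)
    have := h.le_mul
    nlinarith
  by_cases hs0 : s = 0
  · have ht0 : t ≠ 0 := by
      rintro ht0
      apply hst
      rw [hs0, ht0]; simp
    have e1 : (1 : ℝ) ≤ |(t : ℝ) - ζ * s| := by
      rw [hs0]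
      simpa using (by exact_mod_cast Int.one_le_abs ht0 : (1 : ℝ) ≤ |(t : ℝ)|)
    have e2 := one_le_exp_iff.mp (e1.trans hsmall)
    linarith
  · have hs1 : (1 : ℝ) ≤ |(s : ℝ)| := by exact_mod_cast Int.one_le_abs hs0
    have e1 := (h.normalA_right he1).abs_dot4_le hp'
    rw [← hs] at e1
    have e2 := mul_le_mul_of_nonneg_left hev (show 0 ≤ 4 * exp (2 * V + U) by positivity)
    rw [mul_assoc 4 _ (exp (-η' * M)), ← exp_add] at e2
    have e3 := mul_exp_lt_quarter (C := 4) (x := 2 * V + U + -η' * M) (by linarith)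
    have e4 : 4 * C * (exp (V + V - (2 * φ + 1 - e) * U) * exp M) ≤
        exp (4 * C + (M - (1 - 3 * e) * U)) := by
      rw [← exp_add]
      exact mul_exp_le_exp (by linarith)
    have e5 : |(s : ℝ)| ≤ exp (4 * C + (M - (1 - 3 * e) * U)) := by
      rw [← hC] at e1
      linarith
    have e6 := (log_le_iff_le_exp (by linarith)).mpr e5
    have e7 := exp_le_exp.mp ((hrat s t hs0).trans hsmall)
    have e8 := mul_le_mul_of_nonneg_left e6 (show 0 ≤ 1 + e by linarith)
    have e9 : e * C ≤ 1 * C := mul_le_mul_of_nonneg_right he1 (by linarith)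
    linarith

theorem simultaneous_arith {p e K U V M Y r η : ℝ} (hp : 1.618 < p) (hp' : p < 1.6181)
    (hpp : p * p = p + 1) (he : 0 < e) (he' : e ≤ 1 / 200) (hr : r * (p + 2) = p)
    (hη : η = r + 100 * e)
    (hM : K ≤ e * M) (hM0 : 0 < M) (hY : (p + 2) * Y = M) (hUY : U ≤ Y) (hYV : Y ≤ V)
    (hV : V ≤ (p + e) * U) :
    K + M - (2 * p + 1 - e) * V ≤ 0 ∧ K + V - η * M ≤ 0 ∧ K + U - η * M ≤ 0 ∧
      K + U + (1 + e) * (M - (2 * p + 1 - e) * U) - η * M < 0 := by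
  have hY0 : 0 < Y := by
    by_contra hneg
    nlinarith
  have heY : 0 < e * Y := mul_pos he hY0
  have heeY : e * (e * Y) ≤ 1 / 200 * (e * Y) := mul_le_mul_of_nonneg_right he' heY.le
  have hpeY : p * (e * Y) ≤ 1.6181 * (e * Y) := mul_le_mul_of_nonneg_right hp'.le heY.le
  have hKY : K ≤ 4 * (e * Y) := by rw [← hY] at hM; nlinarith
  have hηM : p * Y + 300 * (e * Y) ≤ η * M := by
    rw [hη, ← hY]
    have : (r + 100 * e) * ((p + 2) * Y) = p * Y + 100 * (p * (e * Y)) + 200 * (e * Y) := by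
      linear_combination Y * hr
    nlinarith
  have hU0 : 0 < U := by
    by_contra hneg
    nlinarith
  have hVY : V ≤ p * Y + e * Y := by nlinarith
  have hpe : Y ≤ p * U + e * Y := by nlinarith
  refine ⟨?_, by linarith, by linarith, ?_⟩
  · have : (2 * p + 1 - e) * Y ≤ (2 * p + 1 - e) * V :=
      mul_le_mul_of_nonneg_left hYV (by linarith)
    nlinarith
  · have h1 : 0 ≤ e * U := by positivity
    have h2 : e * (e * U) ≤ 1 / 200 * (e * U) := mul_le_mul_of_nonneg_right he' h1
    have h3 : 1.618 * (e * U) ≤ p * (e * U) := mul_le_mul_of_nonneg_right hp.le h1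
    nlinarith

theorem CubicApprox.abs_shift_sub_le {ζ m l h : ℝ} {x : Fin 4 → ℤ} {a : Fin 3 → ℤ}
    (hx : CubicApprox ζ x m l) (ha : ∀ i, |(a i : ℝ)| ≤ h) :
    |(dot4 x (shift a) : ℝ) - ζ * dot4 x (incl a)| ≤ 3 * (1 + |ζ|) * (l * h) := by
  have hl : 0 ≤ l := (abs_nonneg _).trans (hx.2 0)
  have hh : 0 ≤ h := (abs_nonneg _).trans (ha 0)
  have h1 := hx.2 1
  have h2 := hx.2 2
  have h3 := hx.2 3
  simp only [Fin.val_one, pow_one, Fin.val_two, show ((3 : Fin 4) : ℕ) = 3 from rfl] at h1 h2 h3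
  have : (dot4 x (shift a) : ℝ) - ζ * dot4 x (incl a) = ((x 1 - ζ * x 0) * a 0
      + (x 2 - ζ ^ 2 * x 0) * a 1 + (x 3 - ζ ^ 3 * x 0) * a 2)
      - ζ * ((x 1 - ζ * x 0) * a 1 + (x 2 - ζ ^ 2 * x 0) * a 2) := by
    simp [dot4, shift, incl]; ring
  rw [this]
  have key : ∀ {u v : ℝ}, |u| ≤ l → |v| ≤ h → |u * v| ≤ l * h := fun hu hv => by
    rw [abs_mul]
    exact mul_le_mul hu hv (abs_nonneg _) hl
  refine (abs_sub _ _).trans ((add_le_add (abs_add_three _ _ _)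
    ((abs_mul _ _).le.trans (mul_le_mul_of_nonneg_left (abs_add_le _ _) (abs_nonneg ζ)))).trans ?_)
  have e1 := key h1 (ha 0)
  have e2 := key h2 (ha 1)
  have e3 := key h3 (ha 2)
  have e4 := mul_le_mul_of_nonneg_left (add_le_add (key h1 (ha 1)) (key h2 (ha 2))) (abs_nonneg ζ)
  have e5 : 0 ≤ |ζ| * (l * h) := by positivity
  linarith

theorem eq_zero_of_dot4_eq_zero {a b : Fin 3 → ℤ} (hR : disc (cross a b) ≠ 0) {x : Fin 4 → ℤ}
    (h1 : dot4 x (incl b) = 0) (h2 : dot4 x (shift b) = 0) (h3 : dot4 x (incl a) = 0)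
    (h4 : dot4 x (shift a) = 0) : x = 0 := by
  have key : ∀ p, dot4 x p = 0 := fun p => by
    have := disc_mul_dot4 a b x p h1 h2
    rw [h3, h4] at this
    exact (mul_eq_zero.mp (by linarith)).resolve_left hR
  ext i
  have := key (Pi.single i 1)
  fin_cases i <;> simpa [dot4] using this

theorem le_of_mem_lamSetJ {ζ : ℝ} (hζ : Transcendental ℚ ζ) (hU : UniformApprox ζ) {η : ℝ}
    (hmem : η ∈ lamSetJ 3 1 ζ) : η ≤ 1 / √5 := by
  have hφ := goldenRatio_gt
  have hφ' := goldenRatio_lt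
  have hφφ := goldenRatio_mul_self
  have hr := one_div_sqrt_five_mul
  by_contra! hlt
  set r := 1 / √5 with hrdef
  obtain ⟨e, he, he', hle⟩ : ∃ e : ℝ, 0 < e ∧ e ≤ 1 / 200 ∧ r + 100 * e ≤ η :=
    ⟨min (1 / 200) ((η - r) / 100), lt_min (by norm_num) (by linarith),
      min_le_left _ _, by linarith [min_le_right (1 / 200) ((η - r) / 100)]⟩
  have hmem := lamSetJ_of_le hmem hle
  obtain ⟨η', hη'⟩ : ∃ η', η' = r + 100 * e := ⟨_, rfl⟩
  rw [← hη'] at hmem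
  obtain ⟨b₀, hb₀, hrat⟩ := exists_rational_bound hζ hU he (by linarith)
  obtain ⟨Y₀, hpair⟩ := exists_goodPair hζ hU he (by linarith)
  have hz := abs_nonneg ζ
  set C := 3 * (1 + |ζ|) with hC
  obtain ⟨K, hK⟩ : ∃ K, K = b₀ + C + 10 := ⟨_, rfl⟩
  obtain ⟨X, hX, w, hli, hw⟩ := hmem (exp (max (K / e) (max 1 (4 * Y₀))))
  obtain ⟨x, hxw⟩ : ∃ x : Fin 4 → ℤ, x = w 0 := ⟨_, rfl⟩
  have hx0 : x ≠ 0 := hxw ▸ hli.ne_zero 0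
  obtain ⟨hwX, hwt⟩ := hw 0
  rw [← hxw] at hwX hwt
  have hX0 : 0 < X := (exp_pos _).trans_le hX
  obtain ⟨M, hM⟩ : ∃ M, M = log X := ⟨_, rfl⟩
  have hXM : X = exp M := by rw [hM, exp_log hX0]
  have hM1 : max (K / e) (max 1 (4 * Y₀)) ≤ M := by rw [hM, le_log_iff_exp_le hX0]; exact hX
  have hM2 : K ≤ e * M := by
    have := (le_max_left _ _).trans hM1
    rw [div_le_iff₀ he] at this
    linarith
  have hM3 : 1 ≤ M := (le_max_left _ _).trans ((le_max_right _ _).trans hM1)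
  have hM4 : 4 * Y₀ ≤ M := (le_max_right _ _).trans ((le_max_right _ _).trans hM1)
  rw [rpow_eq_exp hX0, ← hM] at hwt
  have hx : CubicApprox ζ x (exp M) (exp (-η' * M)) := by
    refine ⟨by rw [← hXM]; exact_mod_cast hwX, fun i => ?_⟩
    refine Fin.cases ?_ (fun t => ?_) i
    · simpa using (exp_pos _).le
    · rw [abs_sub_comm, Fin.val_succ]
      exact hwt t
  obtain ⟨Y, hY⟩ : ∃ Y, (φ + 2) * Y = M := ⟨M / (φ + 2), mul_div_cancel₀ _ (by linarith)⟩
  obtain ⟨a, b, U, V, h, hUY, hVY⟩ := hpair Y (by nlinarith)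
  obtain ⟨i1, i2, i3, i4⟩ := simultaneous_arith hφ hφ' hφφ he he' hr hη' hM2 (by linarith) hY hUY
    hVY.le h.le_mul
  have hort : ∀ p : Fin 4 → ℤ, (∀ i, |(p i : ℝ)| ≤ exp V) →
      |cubicEval ζ p| ≤ (1 + |ζ|) * |quadEval ζ b| → dot4 x p = 0 := by
    intro p hp hpb
    apply eq_zero_of_abs_lt_one
    refine (hx.abs_dot4_le hp).trans_lt ?_
    rw [← exp_add]
    have e1 := mul_exp_lt_quarter (C := 3) (x := -η' * M + V) (by linarith)
    have e2 := mul_le_mul_of_nonneg_left (hpb.trans (mul_le_mul_of_nonneg_left h.eval_right_le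
      (show 0 ≤ 1 + |ζ| by linarith))) (exp_pos M).le
    have e3 := mul_exp_lt_quarter (C := 1 + |ζ|) (x := M + -(2 * φ + 1 - e) * V) (by linarith)
    rw [exp_add M] at e3
    linarith
  have hq := abs_nonneg (quadEval ζ b)
  have hib := hort _ (abs_incl_le h.abs_right_le) (by rw [cubicEval_incl]; nlinarith)
  have hsb := hort _ (abs_shift_le h.abs_right_le) (by rw [cubicEval_shift, abs_mul]; nlinarith)
  have hvu := hx.abs_shift_sub_le h.abs_left_le
  have hu := hx.abs_dot4_le (abs_incl_le h.abs_left_le)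
  rw [← exp_add] at hvu hu
  rw [cubicEval_incl] at hu
  have hvu' := hvu.trans_lt (mul_exp_lt_quarter (by linarith))
  set u := dot4 x (incl a) with hudef
  set v := dot4 x (shift a) with hvdef
  have hu0 : u ≠ 0 := by
    intro hu0
    refine hx0 (eq_zero_of_dot4_eq_zero h.disc_ne_zero hib hsb hu0 ?_)
    apply eq_zero_of_abs_lt_one
    rw [hu0] at hvu'
    simp only [Int.cast_zero, mul_zero, sub_zero] at hvu'
    exact hvu'.trans (by norm_num)
  have hu1 : (1 : ℝ) ≤ |(u : ℝ)| := by exact_mod_cast Int.one_le_abs hu0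
  have e1 := mul_le_mul_of_nonneg_left h.eval_left_le (exp_pos M).le
  rw [← exp_add] at e1
  have e2 := mul_exp_lt_quarter (C := 3) (x := -η' * M + U) (by linarith)
  have e3 : |(u : ℝ)| ≤ exp (4 + (M + -(2 * φ + 1 - e) * U)) := by
    refine le_trans ?_ (mul_exp_le_exp (C := 4) le_rfl)
    linarith
  have e4 := (log_le_iff_le_exp (by linarith)).mpr e3
  have e5 := exp_le_exp.mp ((hrat u v hu0).trans (hvu.trans (mul_exp_le_exp le_rfl)))
  have e6 := mul_le_mul_of_nonneg_left e4 (show 0 ≤ 1 + e by linarith)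
  linarith

theorem wExpJ_eq {ζ : ℝ} (hζ : Transcendental ℚ ζ) (hU : UniformApprox ζ) {j : ℕ} (hj : 1 ≤ j)
    (hj' : j ≤ 2) : wExpJ 3 j ζ = 2 * φ + 1 := by
  have hlow : ∀ η < 2 * φ + 1, η ∈ wSetJ 3 j ζ := fun η hη =>
    wSetJ_subset hj' ζ (mem_wSetJ_of_lt hζ hU hη)
  refine csSup_eq_of_forall_le_of_forall_lt_exists_gt ⟨2 * φ, hlow _ (by linarith)⟩
    (fun η hη => le_of_mem_wSetJ hζ hU (wSetJ_subset hj ζ hη)) fun w hw => ?_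
  obtain ⟨η, h1, h2⟩ := exists_between hw
  exact ⟨η, hlow η h2, h1⟩

theorem lamExpJ_eq {ζ : ℝ} (hζ : Transcendental ℚ ζ) (hU : UniformApprox ζ) {j : ℕ} (hj : 1 ≤ j)
    (hj' : j ≤ 2) : lamExpJ 3 j ζ = 1 / √5 := by
  have hlow : ∀ η < 1 / √5, η ∈ lamSetJ 3 j ζ := fun η hη =>
    lamSetJ_subset hj' ζ (mem_lamSetJ_of_lt hζ hU hη)
  refine csSup_eq_of_forall_le_of_forall_lt_exists_gt ⟨1 / √5 - 1, hlow _ (by linarith)⟩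
    (fun η hη => le_of_mem_lamSetJ hζ hU (lamSetJ_subset hj ζ hη)) fun w hw => ?_
  obtain ⟨η, h1, h2⟩ := exists_between hw
  exact ⟨η, hlow η h2, h1⟩

theorem two_mul_goldenRatio_add_one : 2 * φ + 1 = 2 + √5 := by
  unfold Real.goldenRatio; ring

end ExtremalNumber

theorem extremal_minima_12 (ζ : ℝ) (hζ : IsExtremal ζ) :
    wExpJ 3 2 ζ = 2 + Real.sqrt 5 ∧ lamExpJ 3 2 ζ = 1 / Real.sqrt 5 ∧
    wExpJ 3 1 ζ = wExpJ 3 2 ζ ∧ lamExpJ 3 1 ζ = lamExpJ 3 2 ζ := by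
  have hU := hζ.uniformApprox
  have h1 := fun {j} => ExtremalNumber.wExpJ_eq hζ.1 hU (j := j)
  have h2 := fun {j} => ExtremalNumber.lamExpJ_eq hζ.1 hU (j := j)
  rw [h1 (by norm_num) le_rfl, h1 le_rfl (by norm_num), h2 (by norm_num) le_rfl,
    h2 le_rfl (by norm_num)]
  exact ⟨ExtremalNumber.two_mul_goldenRatio_add_one, rfl, rfl, rfl⟩
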